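/- Consider a mechanical control system on T*ℝ^d. If f and g are STAR functions, then: for every λ ∈ ℝ, λf is STAR; if the Hamiltonian vector field of f + g is complete, then f + g is STAR; and if the Hamiltonian vector field of the Poisson bracket {f,g} = Σ_{j=1}^d (∂_{p_j} f ∂_{q_j} g − ∂_{q_j} f ∂_{p_j} g) is complete, then {f,g} is STAR. In other words, the set of STAR functions is a Lie subalgebra of C^∞(ℝ^{2d}, ℝ) with the Poisson bracket. -/

import Mathlib

open MeasureTheory Real

noncomputable section

/-- The phase space `T*ℝ^d = ℝ^d × ℝ^d` (positions `q` and momenta `p`),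
identified with `ℝ^{2d}` with the sup norm and the Lebesgue (symplectic volume) measure. -/
abbrev Phase (d : ℕ) := (Fin d → ℝ) × (Fin d → ℝ)

/-- The Hamiltonian vector field of a function `H : Phase d → ℝ`:
`H⃗(q,p) = (∂_p H(q,p), −∂_q H(q,p))`. -/
def hamVF {d : ℕ} (H : Phase d → ℝ) (x : Phase d) : Phase d :=
  (fun i => fderiv ℝ H x (0, Pi.single i 1),
   fun i => -(fderiv ℝ H x (Pi.single i 1, 0)))

/-- `φ` is the global flow of the (complete) vector field `X`. -/
def IsFlowOf {d : ℕ} (X : Phase d → Phase d) (φ : ℝ → Phase d → Phase d) : Prop :=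
  (∀ x, φ 0 x = x) ∧ ∀ x t, HasDerivAt (fun s => φ s x) (X (φ t x)) t

/-- `Φ` is a smooth diffeomorphism of phase space. -/
def IsDiffeo {d : ℕ} (Φ : Phase d → Phase d) : Prop :=
  ContDiff ℝ (⊤ : ℕ∞) Φ ∧
    ∃ Ψ, ContDiff ℝ (⊤ : ℕ∞) Ψ ∧ Function.LeftInverse Ψ Φ ∧ Function.RightInverse Ψ Φ

/-- `Φ` is a Hamiltonian diffeomorphism of `T*ℝ^d`: a smooth diffeomorphism which is the
time-1 flow map of a smooth time-dependent Hamiltonian whose non-autonomous Hamiltonian flow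
is defined on `[0,1]` from every initial point. -/
def IsHamDiffeo {d : ℕ} (Φ : Phase d → Phase d) : Prop :=
  IsDiffeo Φ ∧
  ∃ (H : ℝ → Phase d → ℝ) (φ : ℝ → Phase d → Phase d),
    ContDiff ℝ (⊤ : ℕ∞) (fun z : ℝ × Phase d => H z.1 z.2) ∧
    (∀ x, φ 0 x = x) ∧
    (∀ x, ∀ t ∈ Set.Icc (0:ℝ) 1,
      HasDerivWithinAt (fun s => φ s x) (hamVF (H t) (φ t x)) (Set.Icc (0:ℝ) 1) t) ∧
    Φ = φ 1

/-- `Φ` is the flow map from time `0` to time `τ` of the time-dependent Hamiltonian vector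
field `H⃗_{u(t)}` for some piecewise constant control `u(·) : [0,τ] → U` (finitely many
pieces): i.e. `Φ` is a finite composition of flows of the autonomous fields `H⃗_{u_i}`
for nonnegative durations summing to `τ`. -/
def Reachable {d : ℕ} {U : Type*} (Ham : U → Phase d → ℝ) (τ : ℝ)
    (Φ : Phase d → Phase d) : Prop :=
  ∃ (n : ℕ) (dur : Fin n → ℝ) (u : Fin n → U) (φ : Fin n → ℝ → Phase d → Phase d),
    (∀ i, 0 ≤ dur i) ∧ (∑ i, dur i) = τ ∧
    (∀ i, IsFlowOf (hamVF (Ham (u i))) (φ i)) ∧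
    Φ = (List.ofFn (fun i => φ i (dur i))).foldl (fun g f => f ∘ g) id

/-- `‖Φ − Ψ‖_{C^ℓ(K)} < ε`: all iterated derivatives of the difference up to order `ℓ`
are smaller than `ε` on `K`. -/
def CloseCl {d : ℕ} (ℓ : ℕ) (K : Set (Phase d)) (ε : ℝ) (Φ Ψ : Phase d → Phase d) : Prop :=
  ∀ j ≤ ℓ, ∀ x ∈ K, ‖iteratedFDeriv ℝ j (fun y => Φ y - Ψ y) x‖ < ε

/-- `Ψ ∈ R̄_st`: the diffeomorphism `Ψ` is small-time approximately reachable for the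
control system with controlled Hamiltonians `Ham u`, `u ∈ U`. -/
def SmallTimeReachable {d : ℕ} {U : Type*} (Ham : U → Phase d → ℝ)
    (Ψ : Phase d → Phase d) : Prop :=
  ∀ ε > 0, ∀ K : Set (Phase d), IsCompact K → ∀ ℓ : ℕ,
    ∃ τ ∈ Set.Icc (0:ℝ) ε, ∃ Φ, Reachable Ham τ Φ ∧ CloseCl ℓ K ε Φ Ψ

/-- A function `f` with complete Hamiltonian vector field is STAR (small-time approximately
reachable) if its flow at every time `s ∈ ℝ` belongs to `R̄_st`. -/
def IsSTAR {d : ℕ} {U : Type*} (Ham : U → Phase d → ℝ) (f : Phase d → ℝ) : Prop :=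
  (∃ φ, IsFlowOf (hamVF f) φ) ∧
  ∀ φ, IsFlowOf (hamVF f) φ → ∀ s : ℝ, SmallTimeReachable Ham (φ s)

/-- The Poisson bracket `{f,g} = Σ_j (∂_{p_j} f ∂_{q_j} g − ∂_{q_j} f ∂_{p_j} g)`. -/
def poissonBracket {d : ℕ} (f g : Phase d → ℝ) : Phase d → ℝ :=
  fun x => ∑ j, (fderiv ℝ f x (0, Pi.single j 1) * fderiv ℝ g x (Pi.single j 1, 0)
      - fderiv ℝ f x (Pi.single j 1, 0) * fderiv ℝ g x (0, Pi.single j 1))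

/-- The mechanical Hamiltonian `H_u(q,p) = |p|²/2 + V_0(q) + Σ_j u_j V_j(q)`. -/
def mechHam {d m : ℕ} (V0 : (Fin d → ℝ) → ℝ) (V : Fin m → (Fin d → ℝ) → ℝ)
    (u : Fin m → ℝ) : Phase d → ℝ :=
  fun x => (∑ i, (x.2 i) ^ 2) / 2 + V0 x.1 + ∑ j, u j * V j x.1

/-- The Euclidean controlled Hamiltonian
`H_u(q,p) = |p|²/2 + V_0(q) + Σ_{j=1}^d u_j q_j + u_{d+1} e^{−|q|²/2}`,
with control `u ∈ ℝ^d × ℝ ≃ ℝ^{d+1}`. -/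
def eucHam {d : ℕ} (V0 : (Fin d → ℝ) → ℝ) (u : (Fin d → ℝ) × ℝ) : Phase d → ℝ :=
  fun x => (∑ i, (x.2 i) ^ 2) / 2 + V0 x.1 + (∑ j, u.1 j * x.1 j)
    + u.2 * Real.exp (-(∑ i, (x.1 i) ^ 2) / 2)

/-- The frequencies `k_1 = e_1, …, k_{d−1} = e_{d−1}, k_d = (1,…,1)`. -/
def kvec (d : ℕ) (j : Fin d) : Fin d → ℝ :=
  if (j : ℕ) < d - 1 then Pi.single j 1 else fun _ => 1

/-- The torus controlled Hamiltonian (lifted to `ℝ^d × ℝ^d`)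
`H_u(q,p) = |p|²/2 + V_0(q) + Σ_{j=1}^d (u_{2j−1} cos(k_j·q) + u_{2j} sin(k_j·q))`,
with control `u ∈ (ℝ²)^d ≃ ℝ^{2d}`. -/
def torusHam {d : ℕ} (V0 : (Fin d → ℝ) → ℝ) (u : Fin d → ℝ × ℝ) : Phase d → ℝ :=
  fun x => (∑ i, (x.2 i) ^ 2) / 2 + V0 x.1 +
    ∑ j, ((u j).1 * Real.cos (∑ i, kvec d j i * x.1 i) +
          (u j).2 * Real.sin (∑ i, kvec d j i * x.1 i))

/-- The vertical shear `(q,p) ↦ (q, p − ∇f(q))`. -/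
def vshear {d : ℕ} (f : (Fin d → ℝ) → ℝ) : Phase d → Phase d :=
  fun x => (x.1, fun i => x.2 i - fderiv ℝ f x.1 (Pi.single i 1))

/-- The horizontal shear `(q,p) ↦ (q + ∇g(p), p)`. -/
def hshear {d : ℕ} (g : (Fin d → ℝ) → ℝ) : Phase d → Phase d :=
  fun x => (fun i => x.1 i + fderiv ℝ g x.2 (Pi.single i 1), x.2)

/-- `M` is a mesh of size `h`: the closed sup-norm cubes `C̄(m_n,h)` cover `ℝ^{2d}` and the
open cubes `C(m_n,h)` are pairwise disjoint. -/
def IsMesh {d : ℕ} (h : ℝ) (M : ℕ → Phase d) : Prop :=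
  (∀ x : Phase d, ∃ n, ‖x - M n‖ ≤ h) ∧
  ∀ n ℓ : ℕ, n ≠ ℓ →
    Disjoint {x : Phase d | ‖x - M n‖ < h} {x : Phase d | ‖x - M ℓ‖ < h}

/-- `F` is a permutation of the mesh `M` of size `h`: a bijection translating every open
cube of the mesh onto another one. -/
def IsMeshPermutation {d : ℕ} (h : ℝ) (M : ℕ → Phase d) (F : Phase d → Phase d) : Prop :=
  Function.Bijective F ∧
  ∀ n : ℕ, ∃ ℓ : ℕ, ∀ x : Phase d, ‖x - M n‖ < h → F x = x + (M ℓ - M n)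

/-- The fundamental domain `Q = [0,2π)^d × ℝ^d` of `T*𝕋^d` in `ℝ^d × ℝ^d`. -/
def torusBlock (d : ℕ) : Set (Phase d) :=
  {x : Phase d | ∀ i, 0 ≤ x.1 i ∧ x.1 i < 2 * Real.pi}

/-- A torus density of class `L^r`: a measurable function on `ℝ^d × ℝ^d`, `2π`-periodic in
each position variable, with finite `L^r` norm on the fundamental domain `Q`. -/
def IsTorusDensity {d : ℕ} (p : ENNReal) (ρ : Phase d → ℝ) : Prop :=
  Measurable ρ ∧
  (∀ (q : Fin d → ℝ) (pp : Fin d → ℝ) (k : Fin d → ℤ),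
    ρ (fun i => q i + 2 * Real.pi * (k i), pp) = ρ (q, pp)) ∧
  eLpNorm ρ p (volume.restrict (torusBlock d)) < ⊤

end

namespace StarAux

open Filter Topology Set Metric
open scoped NNReal

section basic

variable {E F G : Type} [NormedAddCommGroup E] [NormedSpace ℝ E]
  [NormedAddCommGroup F] [NormedSpace ℝ F] [NormedAddCommGroup G] [NormedSpace ℝ G]

/-- Global flow of a vector field on a normed space. -/
def IsFl (X : E → E) (φ : ℝ → E → E) : Prop :=
  (∀ x, φ 0 x = x) ∧ ∀ x t, HasDerivAt (fun s => φ s x) (X (φ t x)) t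

/-- Continuous convergence (equivalent to locally uniform convergence to a continuous limit). -/
def CC (f : ℕ → E → F) (g : E → F) : Prop :=
  ∀ x, Tendsto (fun p : ℕ × E => f p.1 p.2) (atTop ×ˢ 𝓝 x) (𝓝 (g x))

lemma CC.pointwise {f : ℕ → E → F} {g : E → F} (h : CC f g) (x : E) :
    Tendsto (fun n => f n x) atTop (𝓝 (g x)) :=
  (h x).comp (tendsto_id.prodMk (tendsto_const_nhds (x := x)))

lemma CC.continuous {f : ℕ → E → F} {g : E → F} (h : CC f g) : Continuous g := by
  rw [continuous_iff_continuousAt]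
  intro x
  rw [ContinuousAt, Metric.tendsto_nhds]
  intro ε hε
  have h1 := (Metric.tendsto_nhds.1 (h x)) (ε / 2) (by positivity)
  rw [eventually_prod_iff] at h1
  obtain ⟨pa, ha, pb, hb, hab⟩ := h1
  filter_upwards [hb] with y hy
  have h2 : dist (g y) (g x) ≤ ε / 2 := by
    refine le_of_tendsto ((h.pointwise y).dist tendsto_const_nhds) ?_
    filter_upwards [ha] with n hn
    exact (hab hn hy).le
  linarith

lemma CC.comp {f : ℕ → F → G} {g : F → G} {f' : ℕ → E → F} {g' : E → F}
    (h : CC f g) (h' : CC f' g') : CC (fun n => f n ∘ f' n) (g ∘ g') := by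
  intro x
  have key := (h (g' x)).comp (tendsto_fst.prodMk (h' x))
  exact key

/-- On a ball a `C¹` map is Lipschitz. -/
lemma exists_lip [FiniteDimensional ℝ E] {Z : E → F} (hZ : ContDiff ℝ 1 Z) (R : ℝ) :
    ∃ L : ℝ, 0 ≤ L ∧ ∀ x ∈ closedBall (0 : E) R, ∀ y ∈ closedBall (0 : E) R,
      ‖Z x - Z y‖ ≤ L * ‖x - y‖ := by
  have : ProperSpace E := FiniteDimensional.proper ℝ E
  have hc : Continuous (fun x => ‖fderiv ℝ Z x‖) := (hZ.continuous_fderiv one_ne_zero).norm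
  obtain ⟨L, hL⟩ := (isCompact_closedBall (0 : E) R).exists_bound_of_continuousOn hc.continuousOn
  refine ⟨max L 0, le_max_right _ _, fun x hx y hy => ?_⟩
  refine (convex_closedBall (0 : E) R).norm_image_sub_le_of_norm_fderiv_le (𝕜 := ℝ)
    (fun z _ => (hZ.differentiable one_ne_zero) z) (fun z hz => ?_) hy hx
  have := hL z hz
  rw [norm_norm] at this
  exact this.trans (le_max_left _ _)

/-- Consistency of a one-step scheme with the vector field `Z`. -/
def Consistent (S : ℕ → E → E) (Z : E → E) : Prop :=
  ∀ K : Set E, IsCompact K → ∀ ε > 0, ∀ᶠ n : ℕ in atTop, ∀ x ∈ K,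
    ‖S n x - x - (1 / (n : ℝ)) • Z x‖ ≤ ε / n

lemma traj_consistent {Z : E → E} (hZ : Continuous Z) {γ : ℝ → E}
    (hγ : ∀ t, HasDerivAt γ (Z (γ t)) t) {ε : ℝ} (hε : 0 < ε) :
    ∀ᶠ n : ℕ in atTop, ∀ k : ℕ, k < n →
      ‖γ ((k + 1) / n) - γ (k / n) - (1 / (n : ℝ)) • Z (γ (k / n))‖ ≤ ε / n := by
  have hγc : Continuous γ := continuous_iff_continuousAt.2 fun t => (hγ t).continuousAt
  have huc : UniformContinuousOn (fun t => Z (γ t)) (Icc 0 1) :=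
    isCompact_Icc.uniformContinuousOn_of_continuous (hZ.comp hγc).continuousOn
  rw [Metric.uniformContinuousOn_iff_le] at huc
  obtain ⟨δ, hδ, h⟩ := huc ε hε
  have h1 : ∀ᶠ n : ℕ in atTop, 1 / (n : ℝ) < δ :=
    (tendsto_order.1 tendsto_one_div_atTop_nhds_zero_nat).2 δ hδ
  filter_upwards [h1, eventually_gt_atTop 0] with n hn hn0 k hk
  have hn0' : (0 : ℝ) < n := by exact_mod_cast hn0
  have hk' : (k : ℝ) + 1 ≤ n := by exact_mod_cast hk
  set a : ℝ := k / n with ha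
  have hb : ((k : ℝ) + 1) / n = a + 1 / n := by rw [ha]; ring
  have hb1 : a + 1 / n ≤ 1 := by rw [← hb, div_le_one hn0']; exact hk'
  have ha0 : 0 ≤ a := by positivity
  have hinv : (0 : ℝ) < 1 / n := by positivity
  rw [hb]
  have key := (convex_Icc a (a + 1 / n)).norm_image_sub_le_of_norm_hasDerivWithin_le
    (f := fun t => γ t - t • Z (γ a)) (f' := fun t => Z (γ t) - (1 : ℝ) • Z (γ a)) (C := ε)
    (fun t _ => ((hγ t).sub ((hasDerivAt_id t).smul_const (Z (γ a)))).hasDerivWithinAt)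
    (fun t ht => by
      rw [one_smul, ← dist_eq_norm]
      refine h t ⟨ha0.trans ht.1, ht.2.trans hb1⟩ a ⟨ha0, by linarith⟩ ?_
      rw [Real.dist_eq, abs_of_nonneg (by linarith [ht.1])]
      linarith [ht.2])
    (left_mem_Icc.2 (by linarith)) (right_mem_Icc.2 (by linarith))
  have e : γ (a + 1 / n) - (a + 1 / (n : ℝ)) • Z (γ a) - (γ a - a • Z (γ a))
      = γ (a + 1 / n) - γ a - (1 / (n : ℝ)) • Z (γ a) := by
    rw [add_smul]; abel
  rw [e] at key
  refine key.trans (le_of_eq ?_)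
  rw [Real.norm_eq_abs, add_sub_cancel_left, abs_of_pos hinv]; ring

/-- Convergence of consistent one-step schemes. -/
lemma scheme_converges [FiniteDimensional ℝ E] {Z : E → E} (hZ : ContDiff ℝ 1 Z) {γ : ℝ → E}
    (hγ : ∀ t, HasDerivAt γ (Z (γ t)) t) {S : ℕ → E → E} (hS : Consistent S Z) :
    Tendsto (fun p : ℕ × E => (S p.1)^[p.1] p.2) (atTop ×ˢ 𝓝 (γ 0)) (𝓝 (γ 1)) := by
  have : ProperSpace E := FiniteDimensional.proper ℝ E
  have hγc : Continuous γ := continuous_iff_continuousAt.2 fun t => (hγ t).continuousAt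
  obtain ⟨R, hR⟩ := (isCompact_Icc (a := (0 : ℝ)) (b := 1)).exists_bound_of_continuousOn
    hγc.continuousOn
  obtain ⟨L, hL0, hL⟩ := exists_lip hZ (R + 1)
  rw [Metric.tendsto_nhds]
  intro η hη
  set m := min 1 (η / 2) with hm
  have hm0 : 0 < m := by positivity
  set c := m * Real.exp (-L) / 3 with hc
  have hc0 : 0 < c := by positivity
  have hcm : 3 * c * Real.exp L = m := by
    rw [hc]; field_simp; rw [← Real.exp_add]; simp
  have hball : ∀ᶠ y in 𝓝 (γ 0), y ∈ ball (γ 0) c := Metric.ball_mem_nhds _ hc0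
  have h1 := hS _ (isCompact_closedBall (0 : E) (R + 1)) c hc0
  have h2 := traj_consistent hZ.continuous hγ hc0
  have h3 := (h1.and (h2.and (eventually_gt_atTop 0))).prod_mk hball
  filter_upwards [h3] with p hp
  obtain ⟨n, y⟩ := p
  obtain ⟨⟨hs, ht, hn⟩, hy⟩ := hp
  simp only at hs ht hn hy ⊢
  have hn0 : (0 : ℝ) < n := by exact_mod_cast hn
  have main : ∀ k : ℕ, k ≤ n → ‖(S n)^[k] y - γ (k / n)‖ ≤
      (c + 2 * c * (k / n)) * Real.exp (L * (k / n)) := by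
    intro k
    induction k with
    | zero =>
      intro _
      simp only [Function.iterate_zero, id, Nat.cast_zero, zero_div, mul_zero, add_zero,
        Real.exp_zero, mul_one]
      rw [← dist_eq_norm]; exact (mem_ball.1 hy).le
    | succ k ih =>
      intro hk
      have ihk := ih (by omega)
      have hkn : (k : ℝ) / n ≤ 1 := by
        rw [div_le_one hn0]; exact_mod_cast (by omega : k ≤ n)
      have hkn0 : (0 : ℝ) ≤ k / n := by positivity
      set z := (S n)^[k] y with hz
      have hg : ‖γ (k / n)‖ ≤ R := hR _ ⟨hkn0, hkn⟩
      have hbd : ‖z - γ (k / n)‖ ≤ 1 := by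
        refine ihk.trans ?_
        calc (c + 2 * c * (k / n)) * Real.exp (L * (k / n)) ≤ (c + 2 * c * 1) * Real.exp (L * 1) := by
              gcongr
          _ = m := by rw [← hcm, mul_one]; ring
          _ ≤ 1 := min_le_left _ _
      have hzR : z ∈ closedBall (0 : E) (R + 1) := by
        rw [mem_closedBall_zero_iff]
        calc ‖z‖ = ‖γ (k / n) + (z - γ (k / n))‖ := by congr 1; abel
          _ ≤ _ := norm_add_le _ _
          _ ≤ _ := add_le_add hg hbd
      have hgR : γ (k / n) ∈ closedBall (0 : E) (R + 1) := by
        rw [mem_closedBall_zero_iff]; linarith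
      have a1 := hs z hzR
      have a2 := ht k (by omega)
      have a3 := hL z hzR _ hgR
      rw [Function.iterate_succ_apply', ← hz]
      push_cast
      have hinv : (0 : ℝ) ≤ 1 / n := by positivity
      have e : S n z - γ ((k + 1) / n) = (S n z - z - (1 / (n : ℝ)) • Z z)
          - (γ ((k + 1) / n) - γ (k / n) - (1 / (n : ℝ)) • Z (γ (k / n)))
          + (z - γ (k / n)) + (1 / (n : ℝ)) • (Z z - Z (γ (k / n))) := by
        rw [smul_sub]; abel
      have b1 : ‖S n z - γ ((k + 1) / n)‖ ≤ c / n + c / n + ‖z - γ (k / n)‖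
          + (1 / n) * (L * ‖z - γ (k / n)‖) := by
        rw [e]
        refine (norm_add_le _ _).trans (add_le_add ((norm_add_le _ _).trans
          (add_le_add ((norm_sub_le _ _).trans (add_le_add a1 a2)) le_rfl)) ?_)
        rw [norm_smul, Real.norm_eq_abs, abs_of_nonneg hinv]
        gcongr
      have b2 : (1 + L / n) ≤ Real.exp (L / n) := by
        rw [add_comm]; exact Real.add_one_le_exp _
      have b3 : (1 : ℝ) ≤ Real.exp (L * ((k + 1) / n)) := Real.one_le_exp (by positivity)
      have b4 : Real.exp (L * ((k + 1) / n)) = Real.exp (L * (k / n)) * Real.exp (L / n) := by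
        rw [← Real.exp_add]; congr 1; ring
      calc ‖S n z - γ ((k + 1) / n)‖ ≤ 2 * c / n * 1 + (1 + L / n) * ‖z - γ (k / n)‖ := by
            refine b1.trans (le_of_eq ?_); ring
        _ ≤ 2 * c / n * Real.exp (L * ((k + 1) / n)) + Real.exp (L / n) *
            ((c + 2 * c * (k / n)) * Real.exp (L * (k / n))) := by gcongr
        _ = _ := by rw [b4]; ring
  have hfin := main n le_rfl
  rw [div_self hn0.ne', mul_one, mul_one] at hfin
  rw [dist_eq_norm]
  have : (c + 2 * c) * Real.exp L = m := by rw [← hcm]; ring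
  rw [this] at hfin
  have : m ≤ η / 2 := min_le_right _ _
  linarith

lemma scheme_CC [FiniteDimensional ℝ E] {Z : E → E} (hZ : ContDiff ℝ 1 Z) {φ : ℝ → E → E}
    (hφ : IsFl Z φ) {S : ℕ → E → E} (hS : Consistent S Z) :
    CC (fun n => (S n)^[n]) (φ 1) := by
  intro x
  have := scheme_converges hZ (γ := fun t => φ t x) (hφ.2 x) hS
  simpa only [hφ.1 x] using this

end basic

end StarAux

namespace StarAux

open Filter Topology Set Metric
open scoped NNReal

section linode

variable {E : Type} [NormedAddCommGroup E] [NormedSpace ℝ E] [FiniteDimensional ℝ E]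

lemma lin_exists_local {A : ℝ → E →L[ℝ] E} (hA : Continuous A) (v : E) {N : ℝ} (hN : 0 < N) :
    ∃ w : ℝ → E, w 0 = v ∧ ∀ t ∈ Ioo (-N) N, HasDerivAt w (A t (w t)) t := by
  have : ProperSpace E := FiniteDimensional.proper ℝ E
  have : CompleteSpace E := FiniteDimensional.complete ℝ E
  obtain ⟨M, hM⟩ := (isCompact_Icc (a := -N) (b := N)).exists_bound_of_continuousOn
    hA.norm.continuousOn
  have hM0 : 0 ≤ M := (norm_nonneg _).trans (hM 0 ⟨by linarith, hN.le⟩)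
  have hM' : ∀ t ∈ Icc (-N) N, ‖A t‖ ≤ M := fun t ht => by simpa using hM t ht
  set R : ℝ := ‖v‖ * Real.exp (M * N) + 1 with hR
  have hR0 : 0 < R := by positivity
  let χ : ContDiffBump (0 : E) := ⟨R, R + 1, hR0, by linarith⟩
  let ρ : E → E := fun w => χ w • w
  have hρ : ContDiff ℝ 1 ρ := (χ.contDiff).smul contDiff_id
  have hρle : ∀ w, ‖ρ w‖ ≤ ‖w‖ := fun w => by
    simp only [ρ, norm_smul, Real.norm_eq_abs, abs_of_nonneg χ.nonneg]
    exact mul_le_of_le_one_left (norm_nonneg _) χ.le_one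
  have hρR : ∀ w, ‖ρ w‖ ≤ R + 1 := fun w => by
    by_cases hw : ‖w‖ ≤ R + 1
    · exact (hρle w).trans hw
    · have : χ w = 0 := χ.zero_of_le_dist (by
        rw [dist_zero_right]; exact (not_le.1 hw).le)
      simp only [ρ, this, zero_smul, norm_zero]; linarith
  have hρeq : ∀ w, ‖w‖ ≤ R → ρ w = w := fun w hw => by
    have : χ w = 1 := χ.one_of_mem_closedBall (by rw [mem_closedBall_zero_iff]; exact hw)
    simp only [ρ, this, one_smul]
  set B : ℝ := M * (R + 1) with hB
  have hB0 : 0 ≤ B := by positivity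
  obtain ⟨L, hL0, hL⟩ := exists_lip hρ (‖v‖ + B * N)
  have hsub : closedBall v (B * N) ⊆ closedBall (0 : E) (‖v‖ + B * N) := by
    apply closedBall_subset_closedBall'
    rw [dist_zero_right]; linarith
  have hpl : IsPicardLindelof (fun t w => A t (ρ w)) (tmin := -N) (tmax := N)
      ⟨0, by linarith, hN.le⟩ v ⟨B * N, by positivity⟩ 0 ⟨B, hB0⟩ ⟨M * L, by positivity⟩ := by
    refine ⟨?_, ?_, ?_, ?_⟩
    · intro t ht
      refine LipschitzOnWith.of_dist_le_mul fun x hx y hy => ?_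
      rw [dist_eq_norm, dist_eq_norm, ← map_sub]
      refine ((A t).le_opNorm _).trans ?_
      have h2 := hL x (hsub hx) y (hsub hy)
      calc ‖A t‖ * ‖ρ x - ρ y‖ ≤ M * (L * ‖x - y‖) := by
            gcongr; exact hM' t ht
        _ = _ := by rw [← mul_assoc]; rfl
    · intro x _
      exact (hA.clm_apply continuous_const).continuousOn
    · intro t ht x _
      refine ((A t).le_opNorm _).trans ?_
      exact mul_le_mul (hM' t ht) (hρR x) (norm_nonneg _) hM0
    · simp only [sub_zero, zero_sub, neg_neg, max_self, NNReal.coe_zero]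
      exact le_of_eq rfl
  obtain ⟨w, hw0, hw⟩ := hpl.exists_eq_forall_mem_Icc_hasDerivWithinAt₀
  simp only at hw0
  have hwc : ContinuousOn w (Icc (-N) N) := fun t ht => (hw t ht).continuousWithinAt
  have hnorm : ∀ t ∈ Icc (-N) N, ‖A t (ρ (w t))‖ ≤ M * ‖w t‖ + 0 := fun t ht => by
    rw [add_zero]
    exact ((A t).le_opNorm _).trans (mul_le_mul (hM' t ht) (hρle _) (norm_nonneg _) hM0)
  have hbound1 : ∀ t ∈ Icc 0 N, ‖w t‖ ≤ gronwallBound ‖v‖ M 0 (t - 0) := by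
    refine norm_le_gronwallBound_of_norm_deriv_right_le (f' := fun t => A t (ρ (w t)))
      (hwc.mono (Icc_subset_Icc (by linarith) le_rfl)) (fun t ht => ?_) (by rw [hw0])
      (fun t ht => hnorm t ⟨by linarith [ht.1], ht.2.le⟩)
    refine (hw t ⟨by linarith [ht.1], ht.2.le⟩).mono_of_mem_nhdsWithin ?_
    exact Icc_mem_nhdsGE_of_mem ⟨by linarith [ht.1], ht.2⟩
  have hbound2 : ∀ t ∈ Icc 0 N, ‖w (-t)‖ ≤ gronwallBound ‖v‖ M 0 (t - 0) := by
    refine norm_le_gronwallBound_of_norm_deriv_right_le (f := fun t => w (-t))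
      (f' := fun t => -A (-t) (ρ (w (-t))))
      (hwc.comp continuous_neg.continuousOn fun t ht => ⟨by linarith [ht.2], by linarith [ht.1]⟩)
      (fun t ht => ?_) (by simp [hw0])
      (fun t ht => by rw [norm_neg]; exact hnorm _ ⟨by linarith [ht.2], by linarith [ht.1]⟩)
    have h0 : Icc (-N) N ∈ 𝓝[≤] (-t) := by
      have hm : -t ∈ Ioc (-N) N := ⟨by linarith [ht.2], by linarith [ht.1]⟩
      exact Icc_mem_nhdsLE_of_mem hm
    have h1 : HasDerivWithinAt w (A (-t) (ρ (w (-t)))) (Iic (-t)) (-t) :=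
      (hw (-t) ⟨by linarith [ht.2], by linarith [ht.1]⟩).mono_of_mem_nhdsWithin h0
    have h2 := h1.scomp t ((hasDerivAt_neg t).hasDerivWithinAt (s := Ici t))
      (fun s hs => mem_Iic.2 (neg_le_neg (mem_Ici.1 hs)))
    simpa [Function.comp_def] using h2
  have hRb : ∀ t ∈ Icc (-N) N, ‖w t‖ ≤ R := by
    intro t ht
    have h3 : ‖w t‖ ≤ gronwallBound ‖v‖ M 0 |t| := by
      rcases le_total 0 t with h | h
      · have := hbound1 t ⟨h, ht.2⟩
        rw [sub_zero] at this
        rwa [abs_of_nonneg h]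
      · have := hbound2 (-t) ⟨by linarith, by linarith [ht.1]⟩
        rw [neg_neg, sub_zero] at this
        rwa [abs_of_nonpos h]
    rw [gronwallBound_ε0] at h3
    have h4 : Real.exp (M * |t|) ≤ Real.exp (M * N) := by
      apply Real.exp_le_exp.2
      exact mul_le_mul_of_nonneg_left (abs_le.2 ht) hM0
    have := mul_le_mul_of_nonneg_left h4 (norm_nonneg v)
    linarith
  refine ⟨w, hw0, fun t ht => ?_⟩
  have h5 := (hw t ⟨ht.1.le, ht.2.le⟩).hasDerivAt (Icc_mem_nhds ht.1 ht.2)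
  simpa only [hρeq _ (hRb t ⟨ht.1.le, ht.2.le⟩)] using h5

lemma lin_exists {A : ℝ → E →L[ℝ] E} (hA : Continuous A) (v : E) :
    ∃ w : ℝ → E, w 0 = v ∧ ∀ t, HasDerivAt w (A t (w t)) t := by
  have hex := fun N : ℕ => lin_exists_local hA v (N := (N : ℝ) + 1) (by positivity)
  choose w hw0 hw using hex
  have huniq : ∀ N N' : ℕ, N ≤ N' → EqOn (w N) (w N') (Ioo (-((N : ℝ) + 1)) ((N : ℝ) + 1)) := by
    intro N N' hNN
    have hNN' : (N : ℝ) ≤ N' := by exact_mod_cast hNN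
    obtain ⟨M, hM⟩ := (isCompact_Icc (a := -((N : ℝ) + 1)) (b := N + 1)).exists_bound_of_continuousOn
      hA.norm.continuousOn
    have hN0 : (0 : ℝ) ≤ N := by positivity
    refine ODE_solution_unique_of_mem_Ioo (v := fun t x => A t x) (s := fun _ => univ)
      (K := M.toNNReal) (t₀ := 0) ?_ ⟨by linarith, by linarith⟩ (fun t ht => ⟨hw N t ht, trivial⟩)
      (fun t ht => ⟨hw N' t ⟨by linarith [ht.1], by linarith [ht.2]⟩, trivial⟩) (by rw [hw0, hw0])
    intro t ht
    refine LipschitzOnWith.of_dist_le_mul fun x _ y _ => ?_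
    rw [dist_eq_norm, dist_eq_norm, ← map_sub]
    refine ((A t).le_opNorm _).trans ?_
    gcongr
    have := hM t ⟨ht.1.le, ht.2.le⟩
    rw [norm_norm] at this
    exact this.trans (Real.le_coe_toNNReal M)
  refine ⟨fun t => w ⌈|t|⌉₊ t, by simp [hw0], fun t => ?_⟩
  have hev : (fun s => w ⌈|s|⌉₊ s) =ᶠ[𝓝 t] w (⌈|t|⌉₊ + 1) := by
    have h1 : ∀ᶠ s in 𝓝 t, |s| < |t| + 1 :=
      (continuous_abs.tendsto t).eventually (gt_mem_nhds (by linarith))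
    filter_upwards [h1] with s hs
    have h2 : ⌈|s|⌉₊ ≤ ⌈|t|⌉₊ + 1 := by
      rw [Nat.ceil_le]; push_cast
      linarith [Nat.le_ceil |t|]
    refine huniq _ _ h2 ?_
    have := abs_lt.1 (lt_of_le_of_lt (Nat.le_ceil |s|) (lt_add_one _))
    exact ⟨this.1, this.2⟩
  have hmem : t ∈ Ioo (-(((⌈|t|⌉₊ + 1 : ℕ) : ℝ) + 1)) (((⌈|t|⌉₊ + 1 : ℕ) : ℝ) + 1) := by
    have : |t| < ((⌈|t|⌉₊ + 1 : ℕ) : ℝ) + 1 := by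
      push_cast; linarith [Nat.le_ceil |t|]
    exact ⟨(abs_lt.1 this).1, (abs_lt.1 this).2⟩
  have := (hw (⌈|t|⌉₊ + 1) t hmem).congr_of_eventuallyEq hev
  rwa [← hev.self_of_nhds] at this

end linode

end StarAux

namespace StarAux

open Filter Topology Set Metric
open scoped NNReal

section tangent

variable {E F G : Type} [NormedAddCommGroup E] [NormedSpace ℝ E]
  [NormedAddCommGroup F] [NormedSpace ℝ F] [NormedAddCommGroup G] [NormedSpace ℝ G]

/-- The tangent map. -/
noncomputable def Tm (f : E → F) : E × E → F × F := fun z => (f z.1, fderiv ℝ f z.1 z.2)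

lemma Tm_comp {f : F → G} {g : E → F} (hf : Differentiable ℝ f) (hg : Differentiable ℝ g) :
    Tm (f ∘ g) = Tm f ∘ Tm g := by
  funext z
  have := fderiv_comp z.1 (hf (g z.1)) (hg z.1)
  show (f (g z.1), fderiv ℝ (f ∘ g) z.1 z.2) = _
  rw [this]; rfl

lemma Tm_id : Tm (id : E → E) = id := by
  funext z
  simp [Tm]

lemma differentiable_iterate {f : E → E} (hf : Differentiable ℝ f) (n : ℕ) :
    Differentiable ℝ (f^[n]) := hf.iterate n

lemma Tm_iterate {f : E → E} (hf : Differentiable ℝ f) (n : ℕ) :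
    Tm (f^[n]) = (Tm f)^[n] := by
  induction n with
  | zero => exact Tm_id
  | succ n ih => rw [Function.iterate_succ, Tm_comp (hf.iterate n) hf, ih, Function.iterate_succ]

lemma Tm_add {f g : E → F} (hf : Differentiable ℝ f) (hg : Differentiable ℝ g) :
    Tm (fun x => f x + g x) = fun z => Tm f z + Tm g z := by
  funext z
  simp only [Tm]
  rw [fderiv_fun_add (hf _) (hg _)]; rfl

lemma Tm_sub {f g : E → F} (hf : Differentiable ℝ f) (hg : Differentiable ℝ g) :
    Tm (fun x => f x - g x) = fun z => Tm f z - Tm g z := by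
  funext z
  simp only [Tm]
  rw [fderiv_fun_sub (hf _) (hg _)]; rfl

lemma Tm_smul {f : E → F} (hf : Differentiable ℝ f) (c : ℝ) :
    Tm (fun x => c • f x) = fun z => c • Tm f z := by
  funext z
  simp only [Tm]
  rw [fderiv_fun_const_smul (hf _)]; rfl

lemma contDiff_Tm {f : E → F} (hf : ContDiff ℝ (⊤ : ℕ∞) f) : ContDiff ℝ (⊤ : ℕ∞) (Tm f) := by
  refine (hf.comp contDiff_fst).prodMk ?_
  have : ContDiff ℝ (⊤ : ℕ∞) (fderiv ℝ f) := hf.fderiv_right (by simp)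
  exact (this.comp contDiff_fst).clm_apply contDiff_snd

lemma tendsto_clm [FiniteDimensional ℝ E] {α : Type*} {l : Filter α} {f : α → E →L[ℝ] F}
    {L : E →L[ℝ] F} (h : ∀ y, Tendsto (fun a => f a y) l (𝓝 (L y))) : Tendsto f l (𝓝 L) := by
  let e : (E →L[ℝ] F) ≃L[ℝ] Fin (Module.finrank ℝ E) → F :=
    ((ContinuousLinearEquiv.ofFinrankEq (Module.finrank_fin_fun ℝ).symm).arrowCongr
      (1 : F ≃L[ℝ] F)).trans (ContinuousLinearEquiv.piRing _)
  rw [e.toHomeomorph.isInducing.tendsto_nhds_iff]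
  exact tendsto_pi_nhds.2 fun i => h _

/-- If the tangent maps converge, the limit is the tangent map of a differentiable map. -/
lemma hasFDerivAt_of_Tm [FiniteDimensional ℝ E] {f : ℕ → E → F} {g : E → F}
    {H : E × E → F × F} (hf : ∀ n, Differentiable ℝ (f n))
    (hg : ∀ x, Tendsto (fun n => f n x) atTop (𝓝 (g x)))
    (hT : CC (fun n => Tm (f n)) H) :
    ∃ L : E → E →L[ℝ] F, (∀ x, HasFDerivAt g (L x) x) ∧ ∀ x v, L x v = (H (x, v)).2 := by
  have hpt : ∀ x v, Tendsto (fun n => fderiv ℝ (f n) x v) atTop (𝓝 (H (x, v)).2) := fun x v =>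
    (continuous_snd.tendsto _).comp (hT.pointwise (x, v))
  let L0 : E → E →ₗ[ℝ] F := fun x =>
    linearMapOfTendsto (fun v => (H (x, v)).2) (fun n => (fderiv ℝ (f n) x).toLinearMap)
      (tendsto_pi_nhds.2 (hpt x))
  let L : E → E →L[ℝ] F := fun x => LinearMap.toContinuousLinearMap (L0 x)
  have hL : ∀ x v, L x v = (H (x, v)).2 := fun x v => rfl
  have hCC : CC (fun n => fderiv ℝ (f n)) L := by
    intro x
    refine tendsto_clm fun v => ?_
    rw [hL]
    have h1 := hT (x, v)
    have h2 : Tendsto (fun p : ℕ × E => (p.1, (p.2, v))) (atTop ×ˢ 𝓝 x)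
        (atTop ×ˢ 𝓝 (x, v)) := by
      refine tendsto_fst.prodMk ?_
      rw [nhds_prod_eq]
      exact tendsto_snd.prodMk tendsto_const_nhds
    exact (continuous_snd.tendsto _).comp (h1.comp h2)
  refine ⟨L, fun x => ?_, hL⟩
  refine hasFDerivAt_of_tendstoUniformlyOnFilter (l := atTop) (f := f)
    (f' := fun n => fderiv ℝ (f n)) (g' := L) ?_
    (Eventually.of_forall fun p => (hf p.1 p.2).hasFDerivAt) (Eventually.of_forall hg)
  rw [Metric.tendstoUniformlyOnFilter_iff]
  intro ε hε
  have h1 : Tendsto (fun p : ℕ × E => dist (L p.2) (fderiv ℝ (f p.1) p.2)) (atTop ×ˢ 𝓝 x)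
      (𝓝 (dist (L x) (L x))) :=
    ((hCC.continuous.tendsto x).comp tendsto_snd).dist (hCC x)
  rw [dist_self] at h1
  exact (tendsto_order.1 h1).2 ε hε

/-- Euler scheme. -/
noncomputable def eul (X : E → E) (n : ℕ) : E → E := fun x => x + (1 / (n : ℝ)) • X x

lemma eul_consistent (X : E → E) : Consistent (eul X) X := by
  intro K _ ε hε
  refine Eventually.of_forall fun n x _ => ?_
  simp only [eul, add_sub_cancel_left, sub_self, norm_zero]
  positivity

lemma eul_differentiable {X : E → E} (hX : Differentiable ℝ X) (n : ℕ) :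
    Differentiable ℝ (eul X n) := differentiable_id.add (hX.const_smul _)

lemma Tm_eul {X : E → E} (hX : Differentiable ℝ X) (n : ℕ) : Tm (eul X n) = eul (Tm X) n := by
  have h1 : eul X n = fun x => id x + (fun x => (1 / (n : ℝ)) • X x) x := rfl
  have h2 : Differentiable ℝ (fun x => (1 / (n : ℝ)) • X x) := hX.const_smul _
  rw [h1, Tm_add differentiable_id h2, Tm_smul hX, Tm_id]
  rfl

lemma one_le_top' : (1 : WithTop ℕ∞) ≤ ((⊤ : ℕ∞) : WithTop ℕ∞) := by
  exact_mod_cast (le_top : (1 : ℕ∞) ≤ ⊤)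

lemma smooth_diff {f : E → F} (hf : ContDiff ℝ (⊤ : ℕ∞) f) : Differentiable ℝ f :=
  hf.differentiable (by simp)

lemma smooth_one {f : E → F} (hf : ContDiff ℝ (⊤ : ℕ∞) f) : ContDiff ℝ 1 f :=
  have key := hf.of_le one_le_top'
  key

/-- Existence of the tangent flow. -/
lemma exists_Tflow [FiniteDimensional ℝ E] {X : E → E} (hX : ContDiff ℝ (⊤ : ℕ∞) X)
    {φ : ℝ → E → E} (hφ : IsFl X φ) : ∃ Φ, IsFl (Tm X) Φ := by
  have hc : ∀ x, Continuous fun t => φ t x := fun x =>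
    continuous_iff_continuousAt.2 fun t => (hφ.2 x t).continuousAt
  have hA : ∀ x, Continuous fun t => fderiv ℝ X (φ t x) := fun x =>
    ((smooth_one hX).continuous_fderiv one_ne_zero).comp (hc x)
  have hex := fun z : E × E => lin_exists (hA z.1) z.2
  choose w hw0 hw using hex
  refine ⟨fun t z => (φ t z.1, w z t), fun z => by simp only [hφ.1, hw0], fun z t => ?_⟩
  exact (hφ.2 z.1 t).prodMk (hw z t)

lemma Tflow_one [FiniteDimensional ℝ E] {X : E → E} (hX : ContDiff ℝ (⊤ : ℕ∞) X)
    {φ : ℝ → E → E} (hφ : IsFl X φ) {Φ : ℝ → E × E → E × E} (hΦ : IsFl (Tm X) Φ) :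
    Differentiable ℝ (φ 1) ∧ Φ 1 = Tm (φ 1) := by
  have h1 := scheme_CC (smooth_one hX) hφ (eul_consistent X)
  have h2 := scheme_CC (smooth_one (contDiff_Tm hX)) hΦ (eul_consistent (Tm X))
  have hd := smooth_diff hX
  have h3 : (fun n => (eul (Tm X) n)^[n]) = fun n => Tm ((eul X n)^[n]) := by
    funext n
    rw [Tm_iterate (eul_differentiable hd n), Tm_eul hd]
  rw [h3] at h2
  obtain ⟨L, hL, hL2⟩ := hasFDerivAt_of_Tm
    (fun n => (eul_differentiable hd n).iterate n) h1.pointwise h2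
  refine ⟨fun x => (hL x).differentiableAt, ?_⟩
  funext z
  refine Prod.ext ?_ ?_
  · exact tendsto_nhds_unique ((continuous_fst.tendsto _).comp (h2.pointwise z))
      (h1.pointwise z.1)
  · simp only [Tm]
    rw [(hL z.1).fderiv, hL2]

lemma flow_one_contDiff_nat (n : ℕ) : ∀ (E : Type) [NormedAddCommGroup E] [NormedSpace ℝ E]
    [FiniteDimensional ℝ E] (X : E → E) (φ : ℝ → E → E), ContDiff ℝ (⊤ : ℕ∞) X → IsFl X φ →
    ContDiff ℝ n (φ 1) := by
  induction n with
  | zero =>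
    intro E _ _ _ X φ hX hφ
    have h1 := scheme_CC (smooth_one hX) hφ (eul_consistent X)
    exact contDiff_zero.2 h1.continuous
  | succ n ih =>
    intro E _ _ _ X φ hX hφ
    obtain ⟨Φ, hΦ⟩ := exists_Tflow hX hφ
    obtain ⟨hd, hT⟩ := Tflow_one hX hφ hΦ
    have h1 := ih (E × E) (Tm X) Φ (contDiff_Tm hX) hΦ
    push_cast
    rw [contDiff_succ_iff_fderiv_apply]
    refine ⟨hd, fun h => absurd h (by simp), fun y => ?_⟩
    have h2 : (fun x => fderiv ℝ (φ 1) x y) = fun x => (Φ 1 (x, y)).2 := by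
      rw [hT]; rfl
    rw [h2]
    exact contDiff_snd.comp (h1.comp (contDiff_id.prodMk contDiff_const))

lemma flow_one_contDiff [FiniteDimensional ℝ E] {X : E → E} {φ : ℝ → E → E}
    (hX : ContDiff ℝ (⊤ : ℕ∞) X) (hφ : IsFl X φ) : ContDiff ℝ (⊤ : ℕ∞) (φ 1) :=
  contDiff_infty.2 fun n => flow_one_contDiff_nat n E X φ hX hφ

/-- Joint smoothness of a flow. -/
lemma flow_contDiff [FiniteDimensional ℝ E] {X : E → E} {φ : ℝ → E → E}
    (hX : ContDiff ℝ (⊤ : ℕ∞) X) (hφ : IsFl X φ) :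
    ContDiff ℝ (⊤ : ℕ∞) (fun p : ℝ × E => φ p.1 p.2) := by
  have h : IsFl (fun p : ℝ × E => ((0 : ℝ), p.1 • X p.2))
      (fun t p => (p.1, φ (t * p.1) p.2)) := by
    refine ⟨fun p => by simp [hφ.1], fun p t => ?_⟩
    refine (hasDerivAt_const t p.1).prodMk ?_
    have := (hφ.2 p.2 (t * p.1)).scomp t ((hasDerivAt_id t).mul_const p.1)
    simpa [Function.comp_def] using this
  have h1 := flow_one_contDiff (contDiff_const.prodMk (contDiff_fst.smul (hX.comp contDiff_snd))) h
  simpa [Function.comp_def] using contDiff_snd.comp h1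

lemma flow_contDiff_at [FiniteDimensional ℝ E] {X : E → E} {φ : ℝ → E → E}
    (hX : ContDiff ℝ (⊤ : ℕ∞) X) (hφ : IsFl X φ) (t : ℝ) : ContDiff ℝ (⊤ : ℕ∞) (φ t) :=
  (flow_contDiff hX hφ).comp (contDiff_const.prodMk contDiff_id)

lemma IsFl.scale {X : E → E} {φ : ℝ → E → E} (hφ : IsFl X φ) (c : ℝ) :
    IsFl (fun x => c • X x) (fun t => φ (c * t)) := by
  refine ⟨fun x => by simp [hφ.1], fun x t => ?_⟩
  have := (hφ.2 x (c * t)).scomp t ((hasDerivAt_id t).const_mul c)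
  simpa [Function.comp_def] using this

/-- The tangent flow is the flow of the tangent vector field. -/
lemma IsFl.tangent [FiniteDimensional ℝ E] {X : E → E} {φ : ℝ → E → E}
    (hX : ContDiff ℝ (⊤ : ℕ∞) X) (hφ : IsFl X φ) : IsFl (Tm X) (fun t => Tm (φ t)) := by
  obtain ⟨Φ, hΦ⟩ := exists_Tflow hX hφ
  have : (fun t => StarAux.Tm (φ t)) = Φ := by
    funext t
    have h1 := hφ.scale t
    have h2 := hΦ.scale t
    rw [← Tm_smul (smooth_diff hX)] at h2
    have := (Tflow_one (hX.const_smul t) h1 h2).2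
    simpa using this.symm
  rw [this]
  exact hΦ

end tangent

end StarAux

namespace StarAux

open Filter Topology Set Metric
open scoped NNReal

section conv

/-- Convergence of all iterated tangent maps up to order `ℓ`. -/
def TCC : ℕ → ∀ {E F : Type} [NormedAddCommGroup E] [NormedSpace ℝ E]
    [NormedAddCommGroup F] [NormedSpace ℝ F], (ℕ → E → F) → (E → F) → Prop
  | 0, _, _, _, _, _, _, f, g => CC f g
  | ℓ + 1, _, _, _, _, _, _, f, g => TCC ℓ (fun n => Tm (f n)) (Tm g)

lemma TCC.comp (ℓ : ℕ) : ∀ {E F G : Type} [NormedAddCommGroup E] [NormedSpace ℝ E]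
    [NormedAddCommGroup F] [NormedSpace ℝ F] [NormedAddCommGroup G] [NormedSpace ℝ G]
    {f : ℕ → F → G} {g : F → G} {f' : ℕ → E → F} {g' : E → F},
    (∀ n, ContDiff ℝ (⊤ : ℕ∞) (f n)) → ContDiff ℝ (⊤ : ℕ∞) g →
    (∀ n, ContDiff ℝ (⊤ : ℕ∞) (f' n)) → ContDiff ℝ (⊤ : ℕ∞) g' →
    TCC ℓ f g → TCC ℓ f' g' → TCC ℓ (fun n => f n ∘ f' n) (g ∘ g') := by
  induction ℓ with
  | zero =>
    intro E F G _ _ _ _ _ _ f g f' g' _ _ _ _ h h'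
    exact CC.comp h h'
  | succ ℓ ih =>
    intro E F G _ _ _ _ _ _ f g f' g' hf hg hf' hg' h h'
    have := ih (fun n => contDiff_Tm (hf n)) (contDiff_Tm hg) (fun n => contDiff_Tm (hf' n))
      (contDiff_Tm hg') h h'
    simp only [TCC]
    rw [Tm_comp (smooth_diff hg) (smooth_diff hg')]
    have h2 : (fun n => Tm (f n ∘ f' n)) = fun n => Tm (f n) ∘ Tm (f' n) := by
      funext n
      exact Tm_comp (smooth_diff (hf n)) (smooth_diff (hf' n))
    rw [h2]
    exact this

variable {E F : Type} [NormedAddCommGroup E] [NormedSpace ℝ E]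
  [NormedAddCommGroup F] [NormedSpace ℝ F]

def ICC (ℓ : ℕ) (D : ℕ → E → F) : Prop :=
  ∀ j ≤ ℓ, ∀ x, Tendsto (fun p : ℕ × E => ‖iteratedFDeriv ℝ j (D p.1) p.2‖) (atTop ×ˢ 𝓝 x) (𝓝 0)

lemma norm_iter_comp_right {G : Type} [NormedAddCommGroup G] [NormedSpace ℝ G]
    {f : F → G} (hf : ContDiff ℝ (⊤ : ℕ∞) f) (L : E →L[ℝ] F) (x : E) (j : ℕ) :
    ‖iteratedFDeriv ℝ j (f ∘ L) x‖ ≤ ‖iteratedFDeriv ℝ j f (L x)‖ * ‖L‖ ^ j := by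
  rw [L.iteratedFDeriv_comp_right hf x (i := j) (by exact_mod_cast le_top)]
  refine (ContinuousMultilinearMap.norm_compContinuousLinearMap_le _ _).trans ?_
  simp

lemma tz_mul {α : Type*} {l : Filter α} {a b : α → ℝ} {y : ℝ} (ha : Tendsto a l (𝓝 0))
    (hb : Tendsto b l (𝓝 y)) : Tendsto (fun p => a p * b p) l (𝓝 0) := by
  simpa using ha.mul hb

lemma tz_const_mul {α : Type*} {l : Filter α} {a : α → ℝ} (c : ℝ) (ha : Tendsto a l (𝓝 0)) :
    Tendsto (fun p => c * a p) l (𝓝 0) := by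
  simpa using ha.const_mul c

lemma tz_mul_const {α : Type*} {l : Filter α} {a : α → ℝ} (c : ℝ) (ha : Tendsto a l (𝓝 0)) :
    Tendsto (fun p => a p * c) l (𝓝 0) := by
  simpa using ha.mul_const c

lemma tz_add {α : Type*} {l : Filter α} {a b : α → ℝ} (ha : Tendsto a l (𝓝 0))
    (hb : Tendsto b l (𝓝 0)) : Tendsto (fun p => a p + b p) l (𝓝 0) := by
  simpa using ha.add hb

lemma tz_sum {α ι : Type*} {l : Filter α} {s : Finset ι} {a : ι → α → ℝ}
    (ha : ∀ i ∈ s, Tendsto (a i) l (𝓝 0)) : Tendsto (fun p => ∑ i ∈ s, a i p) l (𝓝 0) := by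
  simpa using tendsto_finsetSum s ha

lemma norm_iter_clm_fst {G : Type} [NormedAddCommGroup G] [NormedSpace ℝ G]
    {f : E → F} (hf : ContDiff ℝ (⊤ : ℕ∞) f) (j : ℕ) (z : E × E) :
    ‖iteratedFDeriv ℝ j (fun z : E × E => f z.1) z‖ ≤
      ‖iteratedFDeriv ℝ j f z.1‖ * ‖ContinuousLinearMap.fst ℝ E E‖ ^ j :=
  norm_iter_comp_right hf (ContinuousLinearMap.fst ℝ E E) z j

lemma norm_iter_Tm_le {f : E → F} (hf : ContDiff ℝ (⊤ : ℕ∞) f) (j : ℕ) (z : E × E) :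
    ‖iteratedFDeriv ℝ j (Tm f) z‖ ≤
      ‖iteratedFDeriv ℝ j (fun z : E × E => f z.1) z‖ +
      ‖iteratedFDeriv ℝ j (fun z : E × E => fderiv ℝ f z.1 z.2) z‖ := by
  have hfd : ContDiff ℝ (⊤ : ℕ∞) (fderiv ℝ f) := hf.fderiv_right (by simp)
  have h1 : ContDiff ℝ (⊤ : ℕ∞) (fun z : E × E => f z.1) := hf.comp contDiff_fst
  have h3 : ContDiff ℝ (⊤ : ℕ∞) (fun z : E × E => fderiv ℝ f z.1 z.2) :=
    (hfd.comp contDiff_fst).clm_apply contDiff_snd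
  have hle : ((j : ℕ) : WithTop ℕ∞) ≤ ((⊤ : ℕ∞) : WithTop ℕ∞) := by exact_mod_cast le_top
  have h4 : Tm f = fun z => ((fun z : E × E => f z.1) z,
      (fun z : E × E => fderiv ℝ f z.1 z.2) z) := rfl
  rw [h4, iteratedFDeriv_prodMk h1.contDiffAt h3.contDiffAt hle,
    ContinuousMultilinearMap.opNorm_prod]
  exact max_le_add_of_nonneg (norm_nonneg _) (norm_nonneg _)

lemma norm_iter_Tm_snd_le {f : E → F} (hf : ContDiff ℝ (⊤ : ℕ∞) f) (j : ℕ) (z : E × E) :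
    ‖iteratedFDeriv ℝ j (fun z : E × E => fderiv ℝ f z.1 z.2) z‖ ≤
      ∑ i ∈ Finset.range (j + 1), (j.choose i : ℝ) *
        (‖iteratedFDeriv ℝ (i + 1) f z.1‖ * ‖ContinuousLinearMap.fst ℝ E E‖ ^ i) *
        ‖iteratedFDeriv ℝ (j - i) (fun z : E × E => z.2) z‖ := by
  have hfd : ContDiff ℝ (⊤ : ℕ∞) (fderiv ℝ f) := hf.fderiv_right (by simp)
  have h2 : ContDiff ℝ (⊤ : ℕ∞) (fun z : E × E => fderiv ℝ f z.1) := hfd.comp contDiff_fst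
  have hle : ((j : ℕ) : WithTop ℕ∞) ≤ ((⊤ : ℕ∞) : WithTop ℕ∞) := by exact_mod_cast le_top
  refine (norm_iteratedFDeriv_clm_apply h2 contDiff_snd z hle).trans ?_
  refine Finset.sum_le_sum fun i hi => ?_
  refine mul_le_mul_of_nonneg_right (mul_le_mul_of_nonneg_left ?_ (Nat.cast_nonneg _))
    (norm_nonneg _)
  have h5 := norm_iter_comp_right hfd (ContinuousLinearMap.fst ℝ E E) z i
  rw [norm_iteratedFDeriv_fderiv] at h5
  exact h5

lemma nat_le_top (k : ℕ) : (k : WithTop ℕ∞) ≤ ((⊤ : ℕ∞) : WithTop ℕ∞) := by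
  exact_mod_cast le_top

lemma ICC.app_fst {ℓ : ℕ} {D : ℕ → E → F} (h : ICC ℓ D) {j : ℕ} (hj : j ≤ ℓ) (z : E × E) :
    Tendsto (fun p : ℕ × (E × E) => ‖iteratedFDeriv ℝ j (D p.1) p.2.1‖)
      (atTop ×ˢ 𝓝 z) (𝓝 0) := by
  have h1 := h j hj z.1
  have hfst : Tendsto (fun p : ℕ × (E × E) => (p.1, p.2.1)) (atTop ×ˢ 𝓝 z) (atTop ×ˢ 𝓝 z.1) :=
    tendsto_fst.prodMk ((continuous_fst.tendsto z).comp tendsto_snd)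
  generalize (fun n x => ‖iteratedFDeriv ℝ j (D n) x‖) = Q at h1 ⊢
  have h2 := Tendsto.comp h1 hfst
  exact h2

lemma ICC.toTm {ℓ : ℕ} {D : ℕ → E → F} (hD : ∀ n, ContDiff ℝ (⊤ : ℕ∞) (D n))
    (h : ICC (ℓ + 1) D) : ICC ℓ (fun n => Tm (D n)) := by
  intro j hj z
  have hfst : Tendsto (fun p : ℕ × (E × E) => (p.1, p.2.1)) (atTop ×ˢ 𝓝 z) (atTop ×ˢ 𝓝 z.1) :=
    tendsto_fst.prodMk ((continuous_fst.tendsto z).comp tendsto_snd)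
  have hb : ∀ p : ℕ × (E × E), ‖iteratedFDeriv ℝ j (Tm (D p.1)) p.2‖ ≤
      ‖iteratedFDeriv ℝ j (D p.1) p.2.1‖ * ‖ContinuousLinearMap.fst ℝ E E‖ ^ j +
      ∑ i ∈ Finset.range (j + 1), (j.choose i : ℝ) *
        (‖iteratedFDeriv ℝ (i + 1) (D p.1) p.2.1‖ * ‖ContinuousLinearMap.fst ℝ E E‖ ^ i) *
        ‖iteratedFDeriv ℝ (j - i) (fun z : E × E => z.2) p.2‖ := fun p =>
    (norm_iter_Tm_le (hD p.1) j p.2).trans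
    (add_le_add (norm_iter_comp_right (hD p.1) (ContinuousLinearMap.fst ℝ E E) p.2 j)
    (norm_iter_Tm_snd_le (hD p.1) j p.2))
  refine squeeze_zero (fun _ => norm_nonneg _) hb ?_
  have hj' : j ≤ ℓ + 1 := by omega
  have hA : Tendsto (fun p : ℕ × (E × E) => ‖iteratedFDeriv ℝ j (D p.1) p.2.1‖)
      (atTop ×ˢ 𝓝 z) (𝓝 0) := h.app_fst hj' z
  refine tz_add (tz_mul_const _ hA) ?_
  refine tz_sum fun i hi => ?_
  have hi' := Finset.mem_range.1 hi
  have hi'' : i + 1 ≤ ℓ + 1 := by omega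
  have hc0 : Tendsto (fun p : ℕ × (E × E) => ‖iteratedFDeriv ℝ (i + 1) (D p.1) p.2.1‖)
      (atTop ×ˢ 𝓝 z) (𝓝 0) := h.app_fst hi'' z
  have hc : Continuous (iteratedFDeriv ℝ (j - i) (fun z : E × E => z.2)) :=
    ContDiff.continuous_iteratedFDeriv (n := ((⊤ : ℕ∞) : WithTop ℕ∞))
      (nat_le_top _) contDiff_snd
  have hc1 : Tendsto (fun p : ℕ × (E × E) =>
      ‖iteratedFDeriv ℝ (j - i) (fun z : E × E => z.2) p.2‖) (atTop ×ˢ 𝓝 z) (𝓝 _) := ((hc.norm.tendsto z).comp tendsto_snd)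
  exact tz_mul (tz_const_mul _ (tz_mul_const _ hc0)) hc1

set_option maxHeartbeats 1000000 in
lemma ICC.of_Tm [FiniteDimensional ℝ E] {ℓ : ℕ} {D : ℕ → E → F}
    (hD : ∀ n, ContDiff ℝ (⊤ : ℕ∞) (D n)) (h : ICC ℓ (fun n => StarAux.Tm (D n))) :
    ICC (ℓ + 1) D := by
  intro j hj x
  have hins : ∀ v : E, Tendsto (fun p : ℕ × E => (p.1, (p.2, v))) (atTop ×ˢ 𝓝 x)
      (atTop ×ˢ 𝓝 (x, v)) := fun v => by
    refine tendsto_fst.prodMk ?_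
    rw [nhds_prod_eq]
    exact tendsto_snd.prodMk tendsto_const_nhds
  rcases j with _ | j
  · have h1 := (h 0 (by omega) (x, 0)).comp (hins 0)
    refine squeeze_zero (fun _ => norm_nonneg _) (fun p => ?_) h1
    simp only [Function.comp, norm_iteratedFDeriv_zero]
    exact norm_fst_le (StarAux.Tm (D p.1) (p.2, 0))
  · let b := Module.finBasis ℝ E
    let C : Fin (Module.finrank ℝ E) → E →L[ℝ] ℝ := fun i =>
      LinearMap.toContinuousLinearMap (b.coord i)
    let A : Fin (Module.finrank ℝ E) → F →L[ℝ] (E →L[ℝ] F) := fun i =>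
      ContinuousLinearMap.smulRightL ℝ E F (C i)
    let c : ℝ := ‖ContinuousLinearMap.inl ℝ E E‖
    have hle : ((j : ℕ) : WithTop ℕ∞) ≤ ((⊤ : ℕ∞) : WithTop ℕ∞) := by exact_mod_cast le_top
    have hbound : ∀ p : ℕ × E, ‖iteratedFDeriv ℝ (j + 1) (D p.1) p.2‖ ≤
        ∑ i, ‖A i‖ * (‖ContinuousLinearMap.snd ℝ F F‖ *
          (‖iteratedFDeriv ℝ j (StarAux.Tm (D p.1)) (p.2, b i)‖ * c ^ j)) := by
      intro p
      have hs : ∀ i, ContDiff ℝ (⊤ : ℕ∞) (fun z => StarAux.Tm (D p.1) (z + (0, b i))) := fun i =>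
        (contDiff_Tm (hD p.1)).comp (contDiff_id.add contDiff_const)
      have hk : ∀ i, ContDiff ℝ (⊤ : ℕ∞) ((fun z => StarAux.Tm (D p.1) (z + (0, b i))) ∘
          (ContinuousLinearMap.inl ℝ E E)) := fun i => (hs i).comp (ContinuousLinearMap.contDiff _)
      have hk2 : ∀ i, ContDiff ℝ (⊤ : ℕ∞) ((ContinuousLinearMap.snd ℝ F F) ∘
          ((fun z => StarAux.Tm (D p.1) (z + (0, b i))) ∘ (ContinuousLinearMap.inl ℝ E E))) :=
        fun i => (ContinuousLinearMap.contDiff _).comp (hk i)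
      have hfd : fderiv ℝ (D p.1) = fun y => ∑ i, ((A i) ∘ ((ContinuousLinearMap.snd ℝ F F) ∘
          ((fun z => StarAux.Tm (D p.1) (z + (0, b i))) ∘ (ContinuousLinearMap.inl ℝ E E)))) y := by
        funext y
        ext v
        have hv : fderiv ℝ (D p.1) y v = fderiv ℝ (D p.1) y (∑ i, b.repr v i • b i) := by
          rw [b.sum_repr v]
        rw [hv, map_sum]
        simp [A, C, StarAux.Tm, ContinuousLinearMap.sum_apply]
      rw [← norm_iteratedFDeriv_fderiv, hfd, iteratedFDeriv_fun_sum_apply]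
      · refine (norm_sum_le _ _).trans (Finset.sum_le_sum fun i _ => ?_)
        refine ((A i).norm_iteratedFDeriv_comp_left (hk2 i).contDiffAt hle).trans ?_
        gcongr
        refine (ContinuousLinearMap.norm_iteratedFDeriv_comp_left _ (hk i).contDiffAt hle).trans ?_
        gcongr
        refine (norm_iter_comp_right (hs i) _ _ _).trans ?_
        rw [iteratedFDeriv_comp_add_right]
        simp [c]
      · intro i _
        exact (((A i).contDiff.comp (hk2 i)).of_le hle).contDiffAt
    refine squeeze_zero (fun _ => norm_nonneg _) hbound ?_
    refine tz_sum fun i hi => ?_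
    have hb0 := (h j (by omega) (x, b i)).comp (hins (b i))
    exact tz_const_mul _ (tz_const_mul _ (tz_mul_const _ hb0))

lemma CC_iff_ICC {f : ℕ → E → F} {g : E → F} (hg : Continuous g) :
    CC f g ↔ ICC 0 (fun n x => f n x - g x) := by
  have key : ∀ x, Tendsto (fun p : ℕ × E => f p.1 p.2) (atTop ×ˢ 𝓝 x) (𝓝 (g x)) ↔
      Tendsto (fun p : ℕ × E => ‖f p.1 p.2 - g p.2‖) (atTop ×ˢ 𝓝 x) (𝓝 0) := by
    intro x
    have hgx : Tendsto (fun p : ℕ × E => g p.2) (atTop ×ˢ 𝓝 x) (𝓝 (g x)) :=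
      (hg.tendsto x).comp tendsto_snd
    rw [← tendsto_zero_iff_norm_tendsto_zero]
    constructor
    · intro h
      simpa using h.sub hgx
    · intro h
      simpa using h.add hgx
  constructor
  · intro h j hj x
    obtain rfl : j = 0 := by omega
    simp only [norm_iteratedFDeriv_zero]
    exact (key x).1 (h x)
  · intro h x
    have := h 0 le_rfl x
    simp only [norm_iteratedFDeriv_zero] at this
    exact (key x).2 this

lemma TCC_iff_ICC (ℓ : ℕ) : ∀ {E F : Type} [NormedAddCommGroup E] [NormedSpace ℝ E]
    [FiniteDimensional ℝ E] [NormedAddCommGroup F] [NormedSpace ℝ F] {f : ℕ → E → F} {g : E → F},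
    (∀ n, ContDiff ℝ (⊤ : ℕ∞) (f n)) → ContDiff ℝ (⊤ : ℕ∞) g →
    (TCC ℓ f g ↔ ICC ℓ (fun n x => f n x - g x)) := by
  induction ℓ with
  | zero =>
    intro E F _ _ _ _ _ f g hf hg
    exact CC_iff_ICC hg.continuous
  | succ ℓ ih =>
    intro E F _ _ _ _ _ f g hf hg
    simp only [TCC]
    rw [ih (fun n => contDiff_Tm (hf n)) (contDiff_Tm hg)]
    have h1 : (fun n z => StarAux.Tm (f n) z - StarAux.Tm g z) =
        fun n => StarAux.Tm (fun x => f n x - g x) := by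
      funext n
      rw [Tm_sub (smooth_diff (hf n)) (smooth_diff hg)]
    rw [h1]
    exact ⟨ICC.of_Tm fun n => (hf n).sub hg, ICC.toTm fun n => (hf n).sub hg⟩

/-- Closeness in `C^ℓ(K)`. -/
def Clo (ℓ : ℕ) (K : Set E) (ε : ℝ) (Φ Ψ : E → F) : Prop :=
  ∀ j ≤ ℓ, ∀ x ∈ K, ‖iteratedFDeriv ℝ j (fun y => Φ y - Ψ y) x‖ < ε

lemma ICC.clo {ℓ : ℕ} {f : ℕ → E → F} {g : E → F} (h : ICC ℓ (fun n x => f n x - g x))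
    {K : Set E} (hK : IsCompact K) {ε : ℝ} (hε : 0 < ε) : ∀ᶠ n in atTop, Clo ℓ K ε (f n) g := by
  have h1 : ∀ j ∈ Finset.range (ℓ + 1), ∀ᶠ n in atTop, ∀ x ∈ K,
      ‖iteratedFDeriv ℝ j (fun y => f n y - g y) x‖ < ε := by
    intro j hj
    have hj' := Finset.mem_range.1 hj
    suffices hs : ∀ᶠ n in atTop, ∀ᶠ x in 𝓝ˢ K,
        ‖iteratedFDeriv ℝ j (fun y => f n y - g y) x‖ < ε from
      hs.mono fun n hn => hn.self_of_nhdsSet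
    refine Eventually.curry (la := atTop) (lb := 𝓝ˢ K)
      (p := fun p : ℕ × E => ‖iteratedFDeriv ℝ j (fun y => f p.1 y - g y) p.2‖ < ε) ?_
    rw [hK.prod_nhdsSet_eq_biSup]
    simp only [eventually_iSup]
    intro x _
    exact (tendsto_order.1 (h j (by omega) x)).2 ε hε
  have h3 := (Filter.eventually_all_finset _).2 h1
  filter_upwards [h3] with n hn j hj
  exact hn j (Finset.mem_range.2 (by omega))

lemma ICC_of_clo [FiniteDimensional ℝ E] {f : ℕ → E → F} {g : E → F}
    (h : ∀ k : ℕ, Clo k (closedBall 0 k) (1 / ((k : ℝ) + 1)) (f k) g) (ℓ : ℕ) :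
    ICC ℓ (fun n x => f n x - g x) := by
  intro j hj x
  have h0 : Tendsto (fun p : ℕ × E => 1 / ((p.1 : ℝ) + 1)) (atTop ×ˢ 𝓝 x) (𝓝 0) :=
    tendsto_one_div_add_atTop_nhds_zero_nat.comp tendsto_fst
  refine squeeze_zero' (Eventually.of_forall fun _ => norm_nonneg _) ?_ h0
  obtain ⟨N, hN⟩ := exists_nat_ge (‖x‖ + 1)
  have h1 : ∀ᶠ p : ℕ × E in atTop ×ˢ 𝓝 x, max N j ≤ p.1 :=
    tendsto_fst.eventually (eventually_ge_atTop _)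
  have h2 : ∀ᶠ p : ℕ × E in atTop ×ˢ 𝓝 x, ‖p.2‖ < ‖x‖ + 1 :=
    tendsto_snd.eventually ((continuous_norm.tendsto x).eventually (gt_mem_nhds (by linarith)))
  filter_upwards [h1, h2] with p hp1 hp2
  refine (h p.1 j (le_of_max_le_right hp1) p.2 ?_).le
  rw [mem_closedBall_zero_iff]
  have : (N : ℝ) ≤ p.1 := by exact_mod_cast le_of_max_le_left hp1
  linarith

lemma Clo.trans {ℓ : ℕ} {K : Set E} {ε δ : ℝ} {f g h : E → F} (hf : ContDiff ℝ (⊤ : ℕ∞) f)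
    (hg : ContDiff ℝ (⊤ : ℕ∞) g) (hh : ContDiff ℝ (⊤ : ℕ∞) h) (h1 : Clo ℓ K ε f g)
    (h2 : Clo ℓ K δ g h) : Clo ℓ K (ε + δ) f h := by
  intro j hj x hx
  have h3 : (fun y => f y - h y) = (fun y => f y - g y) + (fun y => g y - h y) := by
    funext y; simp
  have hle : ((j : ℕ) : WithTop ℕ∞) ≤ ((⊤ : ℕ∞) : WithTop ℕ∞) := by exact_mod_cast le_top
  rw [h3, iteratedFDeriv_add_apply (((hf.sub hg).of_le hle).contDiffAt)
    (((hg.sub hh).of_le hle).contDiffAt)]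
  exact (norm_add_le _ _).trans_lt (add_lt_add (h1 j hj x hx) (h2 j hj x hx))

end conv

end StarAux

namespace StarAux

open Filter Topology Set Metric
open scoped NNReal

section trotter

variable {E F : Type} [NormedAddCommGroup E] [NormedSpace ℝ E]
  [NormedAddCommGroup F] [NormedSpace ℝ F]

lemma mvt0 {f f' : ℝ → E} (hf : ∀ t, HasDerivAt f (f' t) t) {h C : ℝ} (hh : 0 ≤ h)
    (hC : ∀ t ∈ Icc 0 h, ‖f' t‖ ≤ C) : ‖f h - f 0‖ ≤ C * h := by
  have := norm_image_sub_le_of_norm_deriv_le_segment' (f := f) (f' := f') (a := 0) (b := h) (C := C)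
    (fun t _ => (hf t).hasDerivWithinAt) (fun t ht => hC t ⟨ht.1, ht.2.le⟩) h ⟨hh, le_rfl⟩
  simpa using this

lemma eq_of_ode [FiniteDimensional ℝ E] {X : E → E} (hX : ContDiff ℝ 1 X) {γ δ : ℝ → E}
    (hγ : ∀ t, HasDerivAt γ (X (γ t)) t) (hδ : ∀ t, HasDerivAt δ (X (δ t)) t) (h0 : γ 0 = δ 0)
    (t : ℝ) : γ t = δ t := by
  have hγc : Continuous γ := continuous_iff_continuousAt.2 fun t => (hγ t).continuousAt
  have hδc : Continuous δ := continuous_iff_continuousAt.2 fun t => (hδ t).continuousAt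
  have ht0 := abs_nonneg t
  obtain ⟨R, hR⟩ := (isCompact_Icc (a := -(|t| + 1)) (b := |t| + 1)).exists_bound_of_continuousOn
    hγc.continuousOn
  obtain ⟨R', hR'⟩ := (isCompact_Icc (a := -(|t| + 1)) (b := |t| + 1)).exists_bound_of_continuousOn
    hδc.continuousOn
  obtain ⟨L, hL0, hL⟩ := exists_lip hX (max R R')
  refine ODE_solution_unique_of_mem_Ioo (v := fun _ x => X x)
    (s := fun _ => closedBall (0 : E) (max R R')) (K := ⟨L, hL0⟩) (t₀ := 0)
    (a := -(|t| + 1)) (b := |t| + 1) ?_ ⟨by linarith, by linarith⟩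
    (fun s hs => ⟨hγ s, ?_⟩) (fun s hs => ⟨hδ s, ?_⟩) h0
    ⟨by linarith [neg_abs_le t], by linarith [le_abs_self t]⟩
  · intro s hs
    refine LipschitzOnWith.of_dist_le_mul fun x hx y hy => ?_
    rw [dist_eq_norm, dist_eq_norm]
    exact hL x hx y hy
  · exact mem_closedBall_zero_iff.2 ((hR s ⟨hs.1.le, hs.2.le⟩).trans (le_max_left _ _))
  · exact mem_closedBall_zero_iff.2 ((hR' s ⟨hs.1.le, hs.2.le⟩).trans (le_max_right _ _))

lemma IsFl.inv [FiniteDimensional ℝ E] {X : E → E} (hX : ContDiff ℝ 1 X) {φ : ℝ → E → E}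
    (hφ : IsFl X φ) (r : ℝ) (x : E) : φ (-r) (φ r x) = x := by
  have h := eq_of_ode hX (γ := fun t => φ t (φ r x)) (δ := fun t => φ (t + r) x)
    (fun t => hφ.2 _ t) (fun t => by
      have := (hφ.2 x (t + r)).scomp t ((hasDerivAt_id t).add_const r)
      simpa [Function.comp_def] using this) (by simp [hφ.1]) (-r)
  simpa [hφ.1] using h

/-- Derivative of `r ↦ φ_{κ r}(c r)` at `0`. -/
lemma IsFl.hasDerivAt_comp [FiniteDimensional ℝ E] {X : E → E} (hX : ContDiff ℝ (⊤ : ℕ∞) X)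
    {φ : ℝ → E → E} (hφ : IsFl X φ) (κ : ℝ) {c : ℝ → E} {c' : E} (hc : HasDerivAt c c' 0) :
    HasDerivAt (fun r => φ (κ * r) (c r)) (κ • X (c 0) + c') 0 := by
  have hP := (smooth_diff (flow_contDiff hX hφ)) (0, c 0)
  have hL := hP.hasFDerivAt
  set L := fderiv ℝ (fun p : ℝ × E => φ p.1 p.2) (0, c 0) with hLdef
  have h1 : HasDerivAt (fun a : ℝ => φ a (c 0)) (L (1, 0)) 0 := by
    have h := hL.comp_hasDerivAt (0 : ℝ) ((hasDerivAt_id (0 : ℝ)).prodMk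
      (hasDerivAt_const (0 : ℝ) (c 0)))
    exact h
  have h1' : L (1, 0) = X (c 0) := by
    have := h1.unique (hφ.2 (c 0) 0)
    rwa [hφ.1] at this
  have h2 : ∀ v, L (0, v) = v := by
    intro v
    have hcv : HasDerivAt (fun a : ℝ => c 0 + a • v) v 0 := by
      simpa using ((hasDerivAt_id (0 : ℝ)).smul_const v).const_add (c 0)
    have hL' : HasFDerivAt (fun p : ℝ × E => φ p.1 p.2) L
        ((fun a : ℝ => ((0 : ℝ), c 0 + a • v)) 0) := by simpa using hL
    have h := hL'.comp_hasDerivAt (0 : ℝ) ((hasDerivAt_const (0 : ℝ) (0 : ℝ)).prodMk hcv)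
    have h' : HasDerivAt (fun a : ℝ => c 0 + a • v) (L (0, v)) 0 := by
      have he : (fun a : ℝ => c 0 + a • v) =
          (fun p : ℝ × E => φ p.1 p.2) ∘ fun a : ℝ => ((0 : ℝ), c 0 + a • v) := by
        funext a; simp [hφ.1]
      rw [he]; exact h
    exact h'.unique hcv
  have hL' : HasFDerivAt (fun p : ℝ × E => φ p.1 p.2) L
      ((fun a : ℝ => (κ * a, c a)) 0) := by simpa using hL
  have hk : HasDerivAt (fun a : ℝ => κ * a) κ 0 := by
    simpa using (hasDerivAt_id (0 : ℝ)).const_mul κ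
  have h := hL'.comp_hasDerivAt (0 : ℝ) (hk.prodMk hc)
  have he : L (κ, c') = κ • X (c 0) + c' := by
    have : ((κ, c') : ℝ × E) = κ • ((1 : ℝ), (0 : E)) + (0, c') := by simp
    rw [this, map_add, map_smul, h1', h2]
  rw [he] at h
  exact h

lemma consistent_of_smooth {S : ℝ → E → E} {Z : E → E}
    (hS : ContDiff ℝ (⊤ : ℕ∞) (fun p : ℝ × E => S p.1 p.2)) (h0 : ∀ x, S 0 x = x)
    (hd : ∀ x, HasDerivAt (fun r => S r x) (Z x) 0) :
    Consistent (fun n => S (1 / (n : ℝ))) Z := by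
  intro K hK ε hε
  let P : ℝ × E → E := fun p => S p.1 p.2
  let D : ℝ → E → E := fun s x => fderiv ℝ P (s, x) (1, 0)
  have hD : ∀ s x, HasDerivAt (fun r => S r x) (D s x) s := fun s x => by
    have hL := ((smooth_diff hS) (s, x)).hasFDerivAt
    exact hL.comp_hasDerivAt s ((hasDerivAt_id s).prodMk (hasDerivAt_const s x))
  have hD0 : ∀ x, D 0 x = Z x := fun x => (hD 0 x).unique (hd x)
  have hDc : Continuous (fun p : ℝ × E => D p.1 p.2) := by
    have : Continuous (fderiv ℝ P) := (smooth_one hS).continuous_fderiv one_ne_zero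
    exact this.clm_apply continuous_const
  have hev : ∀ᶠ s : ℝ in 𝓝 0, ∀ x ∈ K, ‖D s x - D 0 x‖ < ε := by
    refine hK.eventually_forall_of_forall_eventually fun x _ => ?_
    have hc : Continuous (fun p : ℝ × E => ‖D p.1 p.2 - D 0 p.2‖) :=
      (hDc.sub (hDc.comp (continuous_const.prodMk continuous_snd))).norm
    have := hc.tendsto (0, x)
    simp only [sub_self, norm_zero] at this
    exact this.eventually (gt_mem_nhds hε)
  obtain ⟨δ, hδ, hδK⟩ := Metric.eventually_nhds_iff.1 hev
  have hn : ∀ᶠ n : ℕ in atTop, 1 / (n : ℝ) < δ :=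
    (tendsto_order.1 tendsto_one_div_atTop_nhds_zero_nat).2 δ hδ
  filter_upwards [hn] with n hn x hx
  have hn0 : (0 : ℝ) ≤ 1 / n := by positivity
  have := mvt0 (f := fun r => S r x - r • Z x) (f' := fun r => D r x - Z x) (h := 1 / (n : ℝ))
    (C := ε) (fun t => by
      have := (hD t x).fun_sub ((hasDerivAt_id t).smul_const (Z x))
      simpa using this) hn0 (fun t ht => by
      have := hδK (y := t) (by
        rw [dist_zero_right, Real.norm_eq_abs, abs_of_nonneg ht.1]
        exact ht.2.trans_lt hn) x hx
      rw [hD0] at this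
      exact this.le)
  simp only [h0, zero_smul, sub_zero] at this
  rw [sub_right_comm]
  refine this.trans (le_of_eq ?_)
  ring

lemma consistent_of_smooth2 {K : ℝ → ℝ → E → E} {Z : E → E} {G0 : ℝ → E → E}
    (hK : ContDiff ℝ (⊤ : ℕ∞) (fun p : ℝ × ℝ × E => K p.1 p.2.1 p.2.2))
    (h1 : ∀ r x, K r 0 x = x) (h2 : ∀ t x, K 0 t x = x)
    (hG : ∀ r x, HasDerivAt (fun t => K r t x) (G0 r x) 0)
    (hZ : ∀ x, HasDerivAt (fun r => G0 r x) (Z x) 0) :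
    Consistent (fun n => K (1 / √(n : ℝ)) (1 / √(n : ℝ))) Z := by
  intro C hC ε hε
  let P : ℝ × ℝ × E → E := fun p => K p.1 p.2.1 p.2.2
  let G : ℝ × ℝ × E → E := fun p => fderiv ℝ P p (0, 1, 0)
  have hP : ContDiff ℝ (⊤ : ℕ∞) P := hK
  have hGs : ContDiff ℝ (⊤ : ℕ∞) G := by
    have : ContDiff ℝ (⊤ : ℕ∞) (fderiv ℝ P) := hP.fderiv_right (by simp)
    exact this.clm_apply contDiff_const
  let H : ℝ × ℝ × E → E := fun p => fderiv ℝ G p (1, 0, 0)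
  have hHc : Continuous H := by
    have : Continuous (fderiv ℝ G) := (smooth_one hGs).continuous_fderiv one_ne_zero
    exact this.clm_apply continuous_const
  have hdt : ∀ r t x, HasDerivAt (fun t => K r t x) (G (r, t, x)) t := fun r t x => by
    have hL := ((smooth_diff hP) (r, t, x)).hasFDerivAt
    exact hL.comp_hasDerivAt t ((hasDerivAt_const t r).prodMk
      ((hasDerivAt_id t).prodMk (hasDerivAt_const t x)))
  have hdr : ∀ r t x, HasDerivAt (fun r => G (r, t, x)) (H (r, t, x)) r := fun r t x => by
    have hL := ((smooth_diff hGs) (r, t, x)).hasFDerivAt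
    exact hL.comp_hasDerivAt r ((hasDerivAt_id r).prodMk
      ((hasDerivAt_const r t).prodMk (hasDerivAt_const r x)))
  have hGG : ∀ r x, G (r, 0, x) = G0 r x := fun r x => (hdt r 0 x).unique (hG r x)
  have hHZ : ∀ x, H (0, 0, x) = Z x := fun x => by
    have h := hdr 0 0 x
    simp only [hGG] at h
    exact h.unique (hZ x)
  have hG00 : ∀ t x, G (0, t, x) = 0 := fun t x => by
    have h := hdt 0 t x
    simp only [h2] at h
    exact h.unique (hasDerivAt_const t x)
  have hev : ∀ᶠ s : ℝ × ℝ in 𝓝 (0, 0), ∀ x ∈ C, ‖H (s.1, s.2, x) - H (0, 0, x)‖ < ε := by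
    refine hC.eventually_forall_of_forall_eventually fun x _ => ?_
    have hc : Continuous (fun p : (ℝ × ℝ) × E => ‖H (p.1.1, p.1.2, p.2) - H (0, 0, p.2)‖) := by
      fun_prop
    have := hc.tendsto ((0, 0), x)
    simp only [sub_self, norm_zero] at this
    exact this.eventually (gt_mem_nhds hε)
  obtain ⟨δ, hδ, hδK⟩ := Metric.eventually_nhds_iff.1 hev
  have hlim : Tendsto (fun n : ℕ => 1 / √(n : ℝ)) atTop (𝓝 0) := by
    have h : Tendsto (fun n : ℕ => √(n : ℝ)) atTop atTop :=
      Real.tendsto_sqrt_atTop.comp tendsto_natCast_atTop_atTop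
    simpa [Pi.inv_def] using h.inv_tendsto_atTop
  have hn : ∀ᶠ n : ℕ in atTop, 1 / √(n : ℝ) < δ := (tendsto_order.1 hlim).2 δ hδ
  filter_upwards [hn] with n hn x hx
  set s : ℝ := 1 / √(n : ℝ) with hs
  have hs0 : 0 ≤ s := by positivity
  have hs2 : s * s = 1 / (n : ℝ) := by
    rw [hs, div_mul_div_comm, one_mul, Real.mul_self_sqrt (Nat.cast_nonneg n)]
  have hmem : ∀ t ∈ Icc 0 s, |t| < δ := fun t ht => by
    rw [abs_of_nonneg ht.1]; exact ht.2.trans_lt hn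
  have hA : ∀ t ∈ Icc 0 s, ‖G (s, t, x) - s • Z x‖ ≤ ε * s := by
    intro t ht
    have := mvt0 (f := fun r => G (r, t, x) - r • Z x) (f' := fun r => H (r, t, x) - Z x) (h := s)
      (C := ε) (fun r => by
        have := (hdr r t x).fun_sub ((hasDerivAt_id r).smul_const (Z x))
        simpa using this) hs0 (fun r hr => by
        have := hδK (y := (r, t)) (by
          rw [Prod.dist_eq, max_lt_iff, dist_zero_right, dist_zero_right]
          exact ⟨hmem r hr, hmem t ht⟩) x hx
        rw [hHZ] at this
        exact this.le)
    simpa only [hG00, zero_smul, sub_zero] using this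
  have := mvt0 (f := fun t => K s t x - t • (s • Z x)) (f' := fun t => G (s, t, x) - s • Z x)
    (h := s) (C := ε * s) (fun t => by
      have := (hdt s t x).fun_sub ((hasDerivAt_id t).smul_const (s • Z x))
      simpa using this) hs0 hA
  simp only [h1, zero_smul, sub_zero] at this
  rw [sub_right_comm, ← hs2, mul_smul]
  refine this.trans (le_of_eq ?_)
  rw [mul_assoc, hs2]
  ring

/-- Lie bracket of vector fields. -/
noncomputable def lb (X Y : E → E) : E → E := fun x => fderiv ℝ Y x (X x) - fderiv ℝ X x (Y x)

lemma contDiff_lb {X Y : E → E} (hX : ContDiff ℝ (⊤ : ℕ∞) X) (hY : ContDiff ℝ (⊤ : ℕ∞) Y) :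
    ContDiff ℝ (⊤ : ℕ∞) (lb X Y) := by
  have hX' : ContDiff ℝ (⊤ : ℕ∞) (fderiv ℝ X) := hX.fderiv_right (by simp)
  have hY' : ContDiff ℝ (⊤ : ℕ∞) (fderiv ℝ Y) := hY.fderiv_right (by simp)
  exact (hY'.clm_apply hX).sub (hX'.clm_apply hY)

lemma fderiv_Tm {Y : E → F} (hY : ContDiff ℝ (⊤ : ℕ∞) Y) (z w : E × E) :
    fderiv ℝ (Tm Y) z w = (fderiv ℝ Y z.1 w.1,
      fderiv ℝ (fderiv ℝ Y) z.1 w.1 z.2 + fderiv ℝ Y z.1 w.2) := by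
  have hY' : ContDiff ℝ (⊤ : ℕ∞) (fderiv ℝ Y) := hY.fderiv_right (by simp)
  have hfst : HasFDerivAt (Prod.fst : E × E → E) (ContinuousLinearMap.fst ℝ E E) z :=
    hasFDerivAt_fst
  have hsnd : HasFDerivAt (Prod.snd : E × E → E) (ContinuousLinearMap.snd ℝ E E) z :=
    hasFDerivAt_snd
  have h1 := ((smooth_diff hY) z.1).hasFDerivAt.comp z hfst
  have h2 := (((smooth_diff hY') z.1).hasFDerivAt.comp z hfst).clm_apply hsnd
  have h3 : HasFDerivAt (Tm Y) _ z := h1.prodMk h2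
  rw [h3.fderiv]
  refine Prod.ext rfl ?_
  simp [add_comm]

lemma Tm_lb {X Y : E → E} (hX : ContDiff ℝ (⊤ : ℕ∞) X) (hY : ContDiff ℝ (⊤ : ℕ∞) Y) :
    Tm (lb X Y) = lb (Tm X) (Tm Y) := by
  funext z
  have hX' : ContDiff ℝ (⊤ : ℕ∞) (fderiv ℝ X) := hX.fderiv_right (by simp)
  have hY' : ContDiff ℝ (⊤ : ℕ∞) (fderiv ℝ Y) := hY.fderiv_right (by simp)
  have hsym : ∀ {W : E → E}, ContDiff ℝ (⊤ : ℕ∞) W → ∀ u v, fderiv ℝ (fderiv ℝ W) z.1 u v =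
      fderiv ℝ (fderiv ℝ W) z.1 v u := fun {W} hW u v => by
    have := (hW.contDiffAt (x := z.1)).isSymmSndFDerivAt
      (by rw [minSmoothness_of_isRCLikeNormedField]; exact nat_le_top 2)
    exact this u v
  have h1 := (((smooth_diff hY') z.1).hasFDerivAt.clm_apply ((smooth_diff hX) z.1).hasFDerivAt).sub
    (((smooth_diff hX') z.1).hasFDerivAt.clm_apply ((smooth_diff hY) z.1).hasFDerivAt)
  have h2 : HasFDerivAt (lb X Y) _ z.1 := h1
  refine Prod.ext ?_ ?_
  · simp only [lb, fderiv_Tm hX, fderiv_Tm hY, Tm, Prod.fst_sub]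
  · have h3 : (Tm (lb X Y) z).2 = fderiv ℝ (lb X Y) z.1 z.2 := rfl
    rw [h3, h2.fderiv]
    simp only [lb, fderiv_Tm hX, fderiv_Tm hY, Tm, Prod.snd_sub]
    simp only [ContinuousLinearMap.sub_apply, ContinuousLinearMap.add_apply,
      ContinuousLinearMap.comp_apply, ContinuousLinearMap.flip_apply]
    rw [hsym hY z.2, hsym hX z.2]
    abel

lemma trotter_add (ℓ : ℕ) : ∀ (E : Type) [NormedAddCommGroup E] [NormedSpace ℝ E]
    [FiniteDimensional ℝ E] (X Y : E → E) (φ ψ χ : ℝ → E → E), ContDiff ℝ (⊤ : ℕ∞) X →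
    ContDiff ℝ (⊤ : ℕ∞) Y → IsFl X φ → IsFl Y ψ → IsFl (fun x => X x + Y x) χ →
    TCC ℓ (fun n => (φ (1 / (n : ℝ)) ∘ ψ (1 / (n : ℝ)))^[n]) (χ 1) := by
  induction ℓ with
  | zero =>
    intro E _ _ _ X Y φ ψ χ hX hY hφ hψ hχ
    have hφs := flow_contDiff hX hφ
    have hψs := flow_contDiff hY hψ
    refine scheme_CC (smooth_one (hX.add hY)) hχ ?_
    refine consistent_of_smooth (S := fun r => φ r ∘ ψ r) ?_ ?_ ?_
    · exact hφs.comp (contDiff_fst.prodMk hψs)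
    · intro x; simp [hφ.1, hψ.1]
    · intro x
      have h := hφ.hasDerivAt_comp hX 1 (c := fun r => ψ r x) (hψ.2 x 0)
      simpa [hψ.1] using h
  | succ ℓ ih =>
    intro E _ _ _ X Y φ ψ χ hX hY hφ hψ hχ
    have hXY : ContDiff ℝ (⊤ : ℕ∞) (fun x => X x + Y x) := hX.add hY
    have hT := hχ.tangent hXY
    rw [Tm_add (smooth_diff hX) (smooth_diff hY)] at hT
    have h := ih (E × E) (Tm X) (Tm Y) _ _ _ (contDiff_Tm hX) (contDiff_Tm hY)
      (hφ.tangent hX) (hψ.tangent hY) hT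
    simp only [TCC]
    have he : (fun n : ℕ => Tm ((φ (1 / (n : ℝ)) ∘ ψ (1 / (n : ℝ)))^[n])) =
        fun n : ℕ => (Tm (φ (1 / (n : ℝ))) ∘ Tm (ψ (1 / (n : ℝ))))^[n] := by
      funext n
      have h1 := smooth_diff (flow_contDiff_at hX hφ (1 / (n : ℝ)))
      have h2 := smooth_diff (flow_contDiff_at hY hψ (1 / (n : ℝ)))
      rw [Tm_iterate (h1.comp h2), Tm_comp h1 h2]
    rw [he]
    exact h

lemma trotter_lb (ℓ : ℕ) : ∀ (E : Type) [NormedAddCommGroup E] [NormedSpace ℝ E]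
    [FiniteDimensional ℝ E] (X Y : E → E) (φ ψ χ : ℝ → E → E), ContDiff ℝ (⊤ : ℕ∞) X →
    ContDiff ℝ (⊤ : ℕ∞) Y → IsFl X φ → IsFl Y ψ → IsFl (lb X Y) χ →
    TCC ℓ (fun n => (ψ (-(1 / √(n : ℝ))) ∘ φ (-(1 / √(n : ℝ))) ∘ ψ (1 / √(n : ℝ)) ∘
      φ (1 / √(n : ℝ)))^[n]) (χ 1) := by
  induction ℓ with
  | zero =>
    intro E _ _ _ X Y φ ψ χ hX hY hφ hψ hχ
    have hφs := flow_contDiff hX hφ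
    have hψs := flow_contDiff hY hψ
    have hiφ := hφ.inv (smooth_one hX)
    have hiψ := hψ.inv (smooth_one hY)
    refine scheme_CC (smooth_one (contDiff_lb hX hY)) hχ ?_
    refine consistent_of_smooth2 (K := fun r t => ψ (-t) ∘ φ (-r) ∘ ψ t ∘ φ r)
      (G0 := fun r x => (-1 : ℝ) • Y x + (Tm (φ (-r)) (φ r x, Y (φ r x))).2) ?_ ?_ ?_ ?_ ?_
    · have c1 : ContDiff ℝ (⊤ : ℕ∞) (fun p : ℝ × ℝ × E => φ p.1 p.2.2) :=
        hφs.comp (contDiff_fst.prodMk (contDiff_snd.comp contDiff_snd))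
      have c2 : ContDiff ℝ (⊤ : ℕ∞) (fun p : ℝ × ℝ × E => ψ p.2.1 (φ p.1 p.2.2)) :=
        hψs.comp ((contDiff_fst.comp contDiff_snd).prodMk c1)
      have c3 : ContDiff ℝ (⊤ : ℕ∞) (fun p : ℝ × ℝ × E => φ (-p.1) (ψ p.2.1 (φ p.1 p.2.2))) :=
        hφs.comp (contDiff_fst.neg.prodMk c2)
      exact hψs.comp ((contDiff_fst.comp contDiff_snd).neg.prodMk c3)
    · intro r x; simp [hψ.1, hiφ]
    · intro t x; simp [hφ.1, hiψ]
    · intro r x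
      have hc : HasDerivAt (fun t => φ (-r) (ψ t (φ r x)))
          ((Tm (φ (-r)) (φ r x, Y (φ r x))).2) 0 := by
        have hL := ((smooth_diff (flow_contDiff_at hX hφ (-r))) (ψ 0 (φ r x))).hasFDerivAt
        have h := hL.comp_hasDerivAt (0 : ℝ) (hψ.2 (φ r x) 0)
        rw [hψ.1] at h
        exact h
      have h := hψ.hasDerivAt_comp hY (-1) hc
      simpa [hψ.1, hiφ] using h
    · intro x
      have hcc : HasDerivAt (fun r => (φ r x, Y (φ r x))) (X x, fderiv ℝ Y x (X x)) 0 := by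
        have h0 := hφ.2 x 0
        have hL := ((smooth_diff hY) (φ 0 x)).hasFDerivAt
        have h := h0.prodMk (hL.comp_hasDerivAt (0 : ℝ) h0)
        rw [hφ.1] at h
        exact h
      have h := (hφ.tangent hX).hasDerivAt_comp (contDiff_Tm hX) (-1) hcc
      have h' := ((ContinuousLinearMap.snd ℝ E E).hasFDerivAt.comp_hasDerivAt (0 : ℝ) h).const_add
        ((-1 : ℝ) • Y x)
      have he : (ContinuousLinearMap.snd ℝ E E) ((-1 : ℝ) • Tm X (φ 0 x, Y (φ 0 x)) +
          (X x, fderiv ℝ Y x (X x))) = lb X Y x := by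
        simp [Tm, lb, hφ.1]; abel
      rw [he] at h'
      simpa [Function.comp_def] using h'
  | succ ℓ ih =>
    intro E _ _ _ X Y φ ψ χ hX hY hφ hψ hχ
    have hT := hχ.tangent (contDiff_lb hX hY)
    rw [Tm_lb hX hY] at hT
    have h := ih (E × E) (Tm X) (Tm Y) _ _ _ (contDiff_Tm hX) (contDiff_Tm hY)
      (hφ.tangent hX) (hψ.tangent hY) hT
    simp only [TCC]
    have he : (fun n : ℕ => Tm ((ψ (-(1 / √(n : ℝ))) ∘ φ (-(1 / √(n : ℝ))) ∘ ψ (1 / √(n : ℝ)) ∘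
        φ (1 / √(n : ℝ)))^[n])) =
        fun n : ℕ => (Tm (ψ (-(1 / √(n : ℝ)))) ∘ Tm (φ (-(1 / √(n : ℝ)))) ∘ Tm (ψ (1 / √(n : ℝ))) ∘
          Tm (φ (1 / √(n : ℝ))))^[n] := by
      funext n
      have h1 := fun t => smooth_diff (flow_contDiff_at hX hφ t)
      have h2 := fun t => smooth_diff (flow_contDiff_at hY hψ t)
      rw [Tm_iterate ((h2 _).comp ((h1 _).comp ((h2 _).comp (h1 _)))),
        Tm_comp (h2 _) ((h1 _).comp ((h2 _).comp (h1 _))),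
        Tm_comp (h1 _) ((h2 _).comp (h1 _)), Tm_comp (h2 _) (h1 _)]
    rw [he]
    exact h

end trotter

end StarAux

namespace StarAux

open Filter Topology Set Metric
open scoped NNReal

section control

variable {d : ℕ}

/-- The symplectic map from covectors to vectors. -/
noncomputable def Jm (d : ℕ) : (Phase d →L[ℝ] ℝ) →L[ℝ] Phase d :=
  (ContinuousLinearMap.pi fun i =>
    ContinuousLinearMap.apply ℝ ℝ ((0, Pi.single i 1) : Phase d)).prod
  (ContinuousLinearMap.pi fun i =>
    -(ContinuousLinearMap.apply ℝ ℝ ((Pi.single i 1, 0) : Phase d)))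

lemma hamVF_eq (f : Phase d → ℝ) (x : Phase d) : hamVF f x = Jm d (fderiv ℝ f x) := by
  simp only [hamVF, Jm]
  refine Prod.ext ?_ ?_ <;> funext i <;> simp

lemma clm_expand (α : Phase d →L[ℝ] ℝ) (v : Phase d) :
    α v = ∑ i, (α (Pi.single i 1, 0) * v.1 i + α (0, Pi.single i 1) * v.2 i) := by
  have h1 : v = (v.1, 0) + (0, v.2) := by simp
  have h2 : ∀ w : Fin d → ℝ, α (w, 0) = ∑ i, α (Pi.single i 1, 0) * w i := fun w => by
    have := (α.toLinearMap.comp (LinearMap.inl ℝ (Fin d → ℝ) (Fin d → ℝ))).pi_apply_eq_sum_univ w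
    simp only [LinearMap.comp_apply, LinearMap.inl_apply, ContinuousLinearMap.coe_coe,
      smul_eq_mul] at this
    rw [this]
    refine Finset.sum_congr rfl fun i _ => ?_
    rw [mul_comm]
    congr 3
    funext j
    simp [Pi.single_apply, eq_comm]
  have h3 : ∀ w : Fin d → ℝ, α (0, w) = ∑ i, α (0, Pi.single i 1) * w i := fun w => by
    have := (α.toLinearMap.comp (LinearMap.inr ℝ (Fin d → ℝ) (Fin d → ℝ))).pi_apply_eq_sum_univ w
    simp only [LinearMap.comp_apply, LinearMap.inr_apply, ContinuousLinearMap.coe_coe,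
      smul_eq_mul] at this
    rw [this]
    refine Finset.sum_congr rfl fun i _ => ?_
    rw [mul_comm]
    congr 3
    funext j
    simp [Pi.single_apply, eq_comm]
  conv_lhs => rw [h1, map_add, h2, h3]
  rw [← Finset.sum_add_distrib]

lemma Jm_apply (α β : Phase d →L[ℝ] ℝ) : α (Jm d β) =
    ∑ i, (α (Pi.single i 1, 0) * β (0, Pi.single i 1) -
      α (0, Pi.single i 1) * β (Pi.single i 1, 0)) := by
  rw [clm_expand]
  refine Finset.sum_congr rfl fun i _ => ?_
  simp [Jm]
  ring

lemma Jm_antisymm (α β : Phase d →L[ℝ] ℝ) : α (Jm d β) = -β (Jm d α) := by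
  rw [Jm_apply, Jm_apply, ← Finset.sum_neg_distrib]
  refine Finset.sum_congr rfl fun i _ => ?_
  ring

lemma contDiff_hamVF {f : Phase d → ℝ} (hf : ContDiff ℝ (⊤ : ℕ∞) f) :
    ContDiff ℝ (⊤ : ℕ∞) (hamVF f) := by
  have h : ContDiff ℝ (⊤ : ℕ∞) (fderiv ℝ f) := hf.fderiv_right (by simp)
  have he : hamVF f = fun x => Jm d (fderiv ℝ f x) := funext (hamVF_eq f)
  rw [he]
  exact (Jm d).contDiff.comp h

lemma hamVF_add {f g : Phase d → ℝ} (hf : ContDiff ℝ (⊤ : ℕ∞) f) (hg : ContDiff ℝ (⊤ : ℕ∞) g) :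
    hamVF (fun x => f x + g x) = fun x => hamVF f x + hamVF g x := by
  funext x
  rw [hamVF_eq, hamVF_eq, hamVF_eq, fderiv_fun_add (smooth_diff hf x) (smooth_diff hg x), map_add]

lemma hamVF_smul {f : Phase d → ℝ} (hf : ContDiff ℝ (⊤ : ℕ∞) f) (c : ℝ) :
    hamVF (fun x => c * f x) = fun x => c • hamVF f x := by
  funext x
  rw [hamVF_eq, hamVF_eq, fderiv_const_mul (smooth_diff hf x), map_smul]

lemma poisson_eq (f g : Phase d → ℝ) :
    poissonBracket f g = fun x => fderiv ℝ g x (Jm d (fderiv ℝ f x)) := by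
  funext x
  rw [Jm_apply]
  refine Finset.sum_congr rfl fun i _ => ?_
  ring

lemma contDiff_poisson {f g : Phase d → ℝ} (hf : ContDiff ℝ (⊤ : ℕ∞) f)
    (hg : ContDiff ℝ (⊤ : ℕ∞) g) : ContDiff ℝ (⊤ : ℕ∞) (poissonBracket f g) := by
  have h : ContDiff ℝ (⊤ : ℕ∞) (fderiv ℝ f) := hf.fderiv_right (by simp)
  have h' : ContDiff ℝ (⊤ : ℕ∞) (fderiv ℝ g) := hg.fderiv_right (by simp)
  rw [poisson_eq]
  exact h'.clm_apply ((Jm d).contDiff.comp h)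

lemma fderiv_hamVF {f : Phase d → ℝ} (hf : ContDiff ℝ (⊤ : ℕ∞) f) (x v : Phase d) :
    fderiv ℝ (hamVF f) x v = Jm d (fderiv ℝ (fderiv ℝ f) x v) := by
  have h : ContDiff ℝ (⊤ : ℕ∞) (fderiv ℝ f) := hf.fderiv_right (by simp)
  have he : hamVF f = (Jm d) ∘ fderiv ℝ f := funext (hamVF_eq f)
  have h1 := (Jm d).hasFDerivAt.comp x (smooth_diff h x).hasFDerivAt
  rw [he, h1.fderiv]
  rfl

lemma hamVF_poisson {f g : Phase d → ℝ} (hf : ContDiff ℝ (⊤ : ℕ∞) f)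
    (hg : ContDiff ℝ (⊤ : ℕ∞) g) :
    hamVF (poissonBracket f g) = lb (hamVF f) (hamVF g) := by
  funext x
  have h : ContDiff ℝ (⊤ : ℕ∞) (fderiv ℝ f) := hf.fderiv_right (by simp)
  have h' : ContDiff ℝ (⊤ : ℕ∞) (fderiv ℝ g) := hg.fderiv_right (by simp)
  have hsym : ∀ {W : Phase d → ℝ}, ContDiff ℝ (⊤ : ℕ∞) W → ∀ u v,
      fderiv ℝ (fderiv ℝ W) x u v = fderiv ℝ (fderiv ℝ W) x v u := fun {W} hW u v => by
    have := (hW.contDiffAt (x := x)).isSymmSndFDerivAt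
      (by rw [minSmoothness_of_isRCLikeNormedField]; exact nat_le_top 2)
    exact this u v
  have h1 := (smooth_diff h' x).hasFDerivAt.clm_apply
      ((Jm d).hasFDerivAt.comp x (smooth_diff h x).hasFDerivAt)
  have h2 : fderiv ℝ (poissonBracket f g) x =
      fderiv ℝ (fderiv ℝ g) x (hamVF f x) - fderiv ℝ (fderiv ℝ f) x (hamVF g x) := by
    rw [poisson_eq]
    refine h1.fderiv.trans ?_
    refine ContinuousLinearMap.ext fun v => ?_
    simp only [ContinuousLinearMap.sub_apply, ContinuousLinearMap.add_apply,
      ContinuousLinearMap.comp_apply, ContinuousLinearMap.flip_apply, Function.comp]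
    rw [Jm_antisymm, hsym hg, hsym hf _ v, hamVF_eq, hamVF_eq]
    ring
  rw [hamVF_eq, h2, map_sub, lb, fderiv_hamVF hf, fderiv_hamVF hg]

lemma contDiff_mechHam {m : ℕ} {V0 : (Fin d → ℝ) → ℝ} {V : Fin m → (Fin d → ℝ) → ℝ}
    (hV0 : ContDiff ℝ (⊤ : ℕ∞) V0) (hV : ∀ j, ContDiff ℝ (⊤ : ℕ∞) (V j)) (u : Fin m → ℝ) :
    ContDiff ℝ (⊤ : ℕ∞) (mechHam V0 V u) := by
  unfold mechHam
  refine ContDiff.add (ContDiff.add ?_ (hV0.comp contDiff_fst)) ?_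
  · refine ContDiff.div_const (ContDiff.sum fun i _ => ContDiff.pow ?_ 2) 2
    exact (contDiff_apply ℝ ℝ i).comp contDiff_snd
  · exact ContDiff.sum fun j _ => contDiff_const.mul ((hV j).comp contDiff_fst)

variable {U : Type} {Ham : U → Phase d → ℝ}

lemma foldl_comp {α : Type} (l : List (α → α)) (h : α → α) :
    l.foldl (fun g f => f ∘ g) h = (l.foldl (fun g f => f ∘ g) id) ∘ h := by
  induction l generalizing h with
  | nil => rfl
  | cons a l ih =>
    simp only [List.foldl_cons]
    rw [ih (a ∘ h), ih (a ∘ id)]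
    rfl

lemma reachable_id : Reachable Ham 0 (id : Phase d → Phase d) :=
  ⟨0, Fin.elim0, Fin.elim0, Fin.elim0, fun i => i.elim0, by simp, fun i => i.elim0, by simp⟩

lemma reachable_comp {τ σ : ℝ} {Φ Ψ : Phase d → Phase d} (h1 : Reachable Ham τ Φ)
    (h2 : Reachable Ham σ Ψ) : Reachable Ham (τ + σ) (Ψ ∘ Φ) := by
  obtain ⟨n, dur, u, φ, hd, hs, hf, rfl⟩ := h1
  obtain ⟨n', dur', u', φ', hd', hs', hf', rfl⟩ := h2
  refine ⟨n + n', Fin.append dur dur', Fin.append u u', Fin.append φ φ', ?_, ?_, ?_, ?_⟩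
  · intro i
    refine Fin.addCases (fun i => ?_) (fun i => ?_) i
    · simpa using hd i
    · simpa using hd' i
  · rw [Fin.sum_univ_add]
    simp [hs, hs']
  · intro i
    refine Fin.addCases (fun i => ?_) (fun i => ?_) i
    · simpa using hf i
    · simpa using hf' i
  · have h3 : (fun i => Fin.append φ φ' i (Fin.append dur dur' i)) =
        Fin.append (fun i => φ i (dur i)) (fun i => φ' i (dur' i)) := by
      funext i
      refine Fin.addCases (fun i => ?_) (fun i => ?_) i
      · simp
      · simp
    rw [h3, List.ofFn_fin_append, List.foldl_append]
    exact (foldl_comp _ _).symm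

lemma reachable_smooth (hH : ∀ u, ContDiff ℝ (⊤ : ℕ∞) (Ham u)) {τ : ℝ} {Φ : Phase d → Phase d}
    (h : Reachable Ham τ Φ) : ContDiff ℝ (⊤ : ℕ∞) Φ := by
  obtain ⟨n, dur, u, φ, hd, hs, hf, rfl⟩ := h
  have h1 : ∀ l : List (Phase d → Phase d), (∀ a ∈ l, ContDiff ℝ (⊤ : ℕ∞) a) →
      ContDiff ℝ (⊤ : ℕ∞) (l.foldl (fun g f => f ∘ g) id) := by
    intro l
    induction l with
    | nil => intro _; exact contDiff_id
    | cons a l ih =>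
      intro hl
      simp only [List.foldl_cons]
      rw [foldl_comp]
      exact (ih fun b hb => hl b (List.mem_cons_of_mem _ hb)).comp
        ((hl a List.mem_cons_self).comp contDiff_id)
  refine h1 _ fun a ha => ?_
  obtain ⟨i, rfl⟩ := List.mem_ofFn.1 ha
  exact flow_contDiff_at (contDiff_hamVF (hH (u i))) (hf i) (dur i)

lemma str_seq {Ψ : Phase d → Phase d} (h : SmallTimeReachable Ham Ψ) :
    ∃ (τ : ℕ → ℝ) (Φ : ℕ → Phase d → Phase d), ∀ k : ℕ, (τ k ∈ Icc (0 : ℝ) (1 / ((k : ℝ) + 1)) ∧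
      Reachable Ham (τ k) (Φ k)) ∧ Clo k (closedBall 0 k) (1 / ((k : ℝ) + 1)) (Φ k) Ψ := by
  have h1 : ∀ k : ℕ, ∃ τ : ℝ, ∃ Φ : Phase d → Phase d, (τ ∈ Icc (0 : ℝ) (1 / ((k : ℝ) + 1)) ∧
      Reachable Ham τ Φ) ∧ Clo k (closedBall 0 k) (1 / ((k : ℝ) + 1)) Φ Ψ := by
    intro k
    obtain ⟨τ, hτ, Φ, hΦ, hc⟩ := h (1 / ((k : ℝ) + 1)) (by positivity) (closedBall 0 k)
      (isCompact_closedBall _ _) k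
    exact ⟨τ, Φ, ⟨hτ, hΦ⟩, hc⟩
  choose τ Φ h2 using h1
  exact ⟨τ, Φ, h2⟩

lemma str_id : SmallTimeReachable Ham (id : Phase d → Phase d) := by
  intro ε hε K hK ℓ
  refine ⟨0, ⟨le_rfl, hε.le⟩, id, reachable_id, fun j hj x hx => ?_⟩
  have h0 : (fun y : Phase d => id y - id y) = 0 := by funext y; simp
  rw [h0]
  simpa using hε

lemma str_comp (hH : ∀ u, ContDiff ℝ (⊤ : ℕ∞) (Ham u)) {Ψ Ψ' : Phase d → Phase d}
    (hs : ContDiff ℝ (⊤ : ℕ∞) Ψ) (hs' : ContDiff ℝ (⊤ : ℕ∞) Ψ')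
    (h : SmallTimeReachable Ham Ψ) (h' : SmallTimeReachable Ham Ψ') :
    SmallTimeReachable Ham (Ψ' ∘ Ψ) := by
  obtain ⟨τ, Φ, hΦ⟩ := str_seq h
  obtain ⟨τ', Φ', hΦ'⟩ := str_seq h'
  have hsm : ∀ n, ContDiff ℝ (⊤ : ℕ∞) (Φ n) := fun n => reachable_smooth hH (hΦ n).1.2
  have hsm' : ∀ n, ContDiff ℝ (⊤ : ℕ∞) (Φ' n) := fun n => reachable_smooth hH (hΦ' n).1.2
  intro ε hε K hK ℓ
  have h1 := (TCC_iff_ICC ℓ hsm hs).2 (ICC_of_clo (fun k => (hΦ k).2) ℓ)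
  have h2 := (TCC_iff_ICC ℓ hsm' hs').2 (ICC_of_clo (fun k => (hΦ' k).2) ℓ)
  have h3 := TCC.comp ℓ hsm' hs' hsm hs h2 h1
  have h4 := ((TCC_iff_ICC ℓ (fun n => (hsm' n).comp (hsm n)) (hs'.comp hs)).1 h3).clo hK hε
  have h5 : ∀ᶠ k : ℕ in atTop, 1 / ((k : ℝ) + 1) < ε / 2 :=
    (tendsto_order.1 tendsto_one_div_add_atTop_nhds_zero_nat).2 _ (by positivity)
  obtain ⟨k, hk4, hk5⟩ := (h4.and h5).exists
  have a1 := (hΦ k).1.1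
  have a2 := (hΦ' k).1.1
  exact ⟨τ k + τ' k, ⟨add_nonneg a1.1 a2.1, by linarith [a1.2, a2.2]⟩, Φ' k ∘ Φ k,
    reachable_comp (hΦ k).1.2 (hΦ' k).1.2, hk4⟩

lemma smooth_iterate {Ψ : Phase d → Phase d} (hs : ContDiff ℝ (⊤ : ℕ∞) Ψ) (n : ℕ) :
    ContDiff ℝ (⊤ : ℕ∞) (Ψ^[n]) := by
  induction n with
  | zero => exact contDiff_id
  | succ n ih => exact ih.comp hs

lemma str_iterate (hH : ∀ u, ContDiff ℝ (⊤ : ℕ∞) (Ham u)) {Ψ : Phase d → Phase d}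
    (hs : ContDiff ℝ (⊤ : ℕ∞) Ψ) (h : SmallTimeReachable Ham Ψ) (n : ℕ) :
    SmallTimeReachable Ham (Ψ^[n]) := by
  induction n with
  | zero => exact str_id
  | succ n ih => exact str_comp hH hs (smooth_iterate hs n) h ih

lemma str_limit (hH : ∀ u, ContDiff ℝ (⊤ : ℕ∞) (Ham u)) {Ψ : ℕ → Phase d → Phase d}
    {χ : Phase d → Phase d} (hs : ∀ n, ContDiff ℝ (⊤ : ℕ∞) (Ψ n)) (hχ : ContDiff ℝ (⊤ : ℕ∞) χ)
    (h : ∀ n, SmallTimeReachable Ham (Ψ n)) (hT : ∀ ℓ, TCC ℓ Ψ χ) :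
    SmallTimeReachable Ham χ := by
  intro ε hε K hK ℓ
  obtain ⟨n, hn⟩ := (((TCC_iff_ICC ℓ hs hχ).1 (hT ℓ)).clo hK (half_pos hε)).exists
  obtain ⟨τ, hτ, Φ, hΦ, hc⟩ := h n (ε / 2) (half_pos hε) K hK ℓ
  refine ⟨τ, ⟨hτ.1, by linarith [hτ.2]⟩, Φ, hΦ, ?_⟩
  have hc' : Clo ℓ K (ε / 2) Φ (Ψ n) := hc
  have := Clo.trans (reachable_smooth hH hΦ) (hs n) hχ hc' hn
  rw [add_halves] at this
  exact this

lemma star_smul {f : Phase d → ℝ} (hf : ContDiff ℝ (⊤ : ℕ∞) f) (hfS : IsSTAR Ham f) (c : ℝ) :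
    IsSTAR Ham (fun x => c * f x) := by
  obtain ⟨⟨φ, hφ⟩, hS⟩ := hfS
  have hφ' : IsFl (hamVF f) φ := hφ
  have hsc := hφ'.scale c
  rw [← hamVF_smul hf] at hsc
  refine ⟨⟨fun t => φ (c * t), hsc.1, hsc.2⟩, fun χ hχ s => ?_⟩
  have he : χ s = φ (c * s) := by
    funext x
    refine eq_of_ode (smooth_one (contDiff_hamVF (contDiff_const.mul hf)))
      (γ := fun t => χ t x) (δ := fun t => φ (c * t) x) (hχ.2 x) (hsc.2 x) ?_ s
    simp only [hχ.1]
    exact (hsc.1 x).symm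
  rw [he]
  exact hS φ hφ _

lemma star_add (hH : ∀ u, ContDiff ℝ (⊤ : ℕ∞) (Ham u)) {f g : Phase d → ℝ}
    (hf : ContDiff ℝ (⊤ : ℕ∞) f) (hg : ContDiff ℝ (⊤ : ℕ∞) g) (hfS : IsSTAR Ham f)
    (hgS : IsSTAR Ham g) (hc : ∃ φ, IsFlowOf (hamVF (fun x => f x + g x)) φ) :
    IsSTAR Ham (fun x => f x + g x) := by
  obtain ⟨⟨φ, hφ⟩, hS⟩ := hfS
  obtain ⟨⟨ψ, hψ⟩, hS'⟩ := hgS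
  refine ⟨hc, fun χ hχ s => ?_⟩
  have hφ' : IsFl (hamVF f) φ := hφ
  have hψ' : IsFl (hamVF g) ψ := hψ
  have hχ' : IsFl (hamVF (fun x => f x + g x)) χ := hχ
  have hX := contDiff_hamVF hf
  have hY := contDiff_hamVF hg
  have hs1 := flow_contDiff_at hX hφ'
  have hs2 := flow_contDiff_at hY hψ'
  have h3 := hχ'.scale s
  rw [hamVF_add hf hg] at h3
  simp only [smul_add] at h3
  have hT := fun ℓ => trotter_add ℓ (Phase d) _ _ _ _ _ (hX.const_smul s) (hY.const_smul s)
    (hφ'.scale s) (hψ'.scale s) h3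
  simp only [mul_one] at hT
  refine str_limit hH (fun n => ?_) (flow_contDiff_at (contDiff_hamVF (hf.add hg)) hχ' s)
    (fun n => ?_) hT
  · exact smooth_iterate ((hs1 _).comp (hs2 _)) n
  · exact str_iterate hH ((hs1 _).comp (hs2 _))
      (str_comp hH (hs2 _) (hs1 _) (hS' ψ hψ _) (hS φ hφ _)) n

lemma star_poisson (hH : ∀ u, ContDiff ℝ (⊤ : ℕ∞) (Ham u)) {f g : Phase d → ℝ}
    (hf : ContDiff ℝ (⊤ : ℕ∞) f) (hg : ContDiff ℝ (⊤ : ℕ∞) g) (hfS : IsSTAR Ham f)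
    (hgS : IsSTAR Ham g) (hc : ∃ φ, IsFlowOf (hamVF (poissonBracket f g)) φ) :
    IsSTAR Ham (poissonBracket f g) := by
  obtain ⟨⟨φ, hφ⟩, hS⟩ := hfS
  obtain ⟨⟨ψ, hψ⟩, hS'⟩ := hgS
  refine ⟨hc, fun χ hχ s => ?_⟩
  have hφ' : IsFl (hamVF f) φ := hφ
  have hψ' : IsFl (hamVF g) ψ := hψ
  have hχ' : IsFl (hamVF (poissonBracket f g)) χ := hχ
  have hX := contDiff_hamVF hf
  have hY := contDiff_hamVF hg
  have hs1 := flow_contDiff_at hX hφ'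
  have hs2 := flow_contDiff_at hY hψ'
  have h3 := hχ'.scale s
  have hlb : (fun x => s • hamVF (poissonBracket f g) x) =
      lb (fun x => s • hamVF f x) (hamVF g) := by
    funext x
    rw [hamVF_poisson hf hg]
    simp only [lb]
    rw [fderiv_fun_const_smul (smooth_diff hX x), map_smul, smul_sub]
    rfl
  rw [hlb] at h3
  have hT := fun ℓ => trotter_lb ℓ (Phase d) _ _ _ _ _ (hX.const_smul s) hY
    (hφ'.scale s) hψ' h3
  simp only [mul_one] at hT
  refine str_limit hH (fun n => ?_)
    (flow_contDiff_at (contDiff_hamVF (contDiff_poisson hf hg)) hχ' s) (fun n => ?_) hT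
  · exact smooth_iterate ((hs2 _).comp ((hs1 _).comp ((hs2 _).comp (hs1 _)))) n
  · refine str_iterate hH ((hs2 _).comp ((hs1 _).comp ((hs2 _).comp (hs1 _)))) ?_ n
    refine str_comp hH ((hs1 _).comp ((hs2 _).comp (hs1 _))) (hs2 _) ?_ (hS' ψ hψ _)
    refine str_comp hH ((hs2 _).comp (hs1 _)) (hs1 _) ?_ (hS φ hφ _)
    exact str_comp hH (hs1 _) (hs2 _) (hS φ hφ _) (hS' ψ hψ _)

end control

end StarAux

/-- **Proposition (STAR functions form a Lie subalgebra).**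
For a mechanical control system on `T*ℝ^d` with complete Hamiltonian vector fields: if
`f, g` are smooth STAR functions, then every scalar multiple `λf` is STAR; if the
Hamiltonian vector field of `f + g` is complete then `f + g` is STAR; and if the
Hamiltonian vector field of the Poisson bracket `{f,g}` is complete then `{f,g}` is STAR. -/
theorem star_functions_lie_subalgebra
    (d m : ℕ) (V0 : (Fin d → ℝ) → ℝ) (V : Fin m → (Fin d → ℝ) → ℝ)
    (hV0 : ContDiff ℝ (⊤ : ℕ∞) V0) (hV : ∀ j, ContDiff ℝ (⊤ : ℕ∞) (V j))
    (hcomplete : ∀ u : Fin m → ℝ, ∃ φ, IsFlowOf (hamVF (mechHam V0 V u)) φ)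
    (f g : Phase d → ℝ) (hf : ContDiff ℝ (⊤ : ℕ∞) f) (hg : ContDiff ℝ (⊤ : ℕ∞) g)
    (hfS : IsSTAR (mechHam V0 V) f) (hgS : IsSTAR (mechHam V0 V) g) :
    (∀ c : ℝ, IsSTAR (mechHam V0 V) (fun x => c * f x)) ∧
    ((∃ φ, IsFlowOf (hamVF (fun x => f x + g x)) φ) →
      IsSTAR (mechHam V0 V) (fun x => f x + g x)) ∧
    ((∃ φ, IsFlowOf (hamVF (poissonBracket f g)) φ) →
      IsSTAR (mechHam V0 V) (poissonBracket f g)) := by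
  have hH := StarAux.contDiff_mechHam hV0 hV
  exact ⟨fun c => StarAux.star_smul hf hfS c,
    fun hc => StarAux.star_add hH hf hg hfS hgS hc,
    fun hc => StarAux.star_poisson hH hf hg hfS hgS hc⟩
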